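/- arXiv:1311.4748 — 2 statements merged into one kernel-verified Lean document; each statement's English description precedes it below -/
import Mathlib

section
/- For all integers N and d with N ≥ d + 2 > 4 (i.e., d ≥ 3 and N ≥ d + 2), the set 𝓕_{N,d}^ℝ is an irreducible real algebraic variety: for any two polynomials p and q with real coefficients in the dN real variables given by the entries of a d×N real matrix, if every F ∈ 𝓕_{N,d}^ℝ satisfies p(F) = 0 or q(F) = 0, then p vanishes at every point of 𝓕_{N,d}^ℝ, or q vanishes at every point of 𝓕_{N,d}^ℝ. -/
noncomputable section

/-- The set of finite unit norm tight frames (FUNTFs) of `N` vectors in `𝕜^d`,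
viewed as `d × N` matrices `F` with unit-norm columns and `F * Fᴴ = (N/d) • 1`. -/
def FUNTF (𝕜 : Type*) [RCLike 𝕜] (N d : ℕ) : Set (Matrix (Fin d) (Fin N) 𝕜) :=
  {F | F * F.conjTranspose = ((N : 𝕜) / (d : 𝕜)) • 1 ∧
       ∀ n, (F.conjTranspose * F) n n = 1}

/-- Evaluation of a real polynomial in the `dN` real variables given by the entries of a
`d × N` real matrix. -/
def evalEntries {d N : ℕ} (p : MvPolynomial (Fin d × Fin N) ℝ)
    (F : Matrix (Fin d) (Fin N) ℝ) : ℝ :=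
  MvPolynomial.eval (fun v => F v.1 v.2) p

namespace FuntfAux
open Matrix
open scoped Topology ContDiff

/-- The Gram graph of the family `v` is connected. -/
def Conn {N d : ℕ} (v : Fin N → Fin d → ℝ) : Prop :=
  ∀ S : Set (Fin N), S.Nonempty → Sᶜ.Nonempty → ∃ i ∈ S, ∃ j ∈ Sᶜ, v i ⬝ᵥ v j ≠ 0

/-- squared norm of `g f_n`. -/
def rr {N d : ℕ} (g : Matrix (Fin d) (Fin d) ℝ) (f : Fin N → Fin d → ℝ) (n : Fin N) : ℝ :=
  (g *ᵥ f n) ⬝ᵥ (g *ᵥ f n)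

/-- frame operator of the normalisation of `g f`. -/
def TT {N d : ℕ} (g : Matrix (Fin d) (Fin d) ℝ) (f : Fin N → Fin d → ℝ) :
    Matrix (Fin d) (Fin d) ℝ :=
  ∑ n, (rr g f n)⁻¹ • vecMulVec (g *ᵥ f n) (g *ᵥ f n)

/-- `g` brings `f` to a (connected) tight position. -/
structure Sol {N d : ℕ} (f : Fin N → Fin d → ℝ) (g : Matrix (Fin d) (Fin d) ℝ) : Prop where
  pos : g.PosDef
  tr : g.trace = d
  ne : ∀ n, f n ≠ 0
  tight : TT g f = ((N : ℝ) / d) • (1 : Matrix (Fin d) (Fin d) ℝ)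
  conn : Conn (fun n => g *ᵥ f n)

lemma pd_symm {d : ℕ} {g : Matrix (Fin d) (Fin d) ℝ} (h : g.PosDef) : gᵀ = g := by
  have := h.isHermitian
  simpa [Matrix.IsHermitian] using this

lemma pd_pos {d : ℕ} {g : Matrix (Fin d) (Fin d) ℝ} (h : g.PosDef) {x : Fin d → ℝ} (hx : x ≠ 0) :
    0 < x ⬝ᵥ g *ᵥ x := by
  have := h.dotProduct_mulVec_pos hx
  simpa using this

lemma pd_of {d : ℕ} {g : Matrix (Fin d) (Fin d) ℝ} (hs : gᵀ = g)
    (h : ∀ x : Fin d → ℝ, x ≠ 0 → 0 < x ⬝ᵥ g *ᵥ x) : g.PosDef := by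
  refine Matrix.PosDef.of_dotProduct_mulVec_pos ?_ ?_
  · simpa [Matrix.IsHermitian] using hs
  · intro x hx
    simpa using h x hx

lemma dot_pos {d : ℕ} {x : Fin d → ℝ} (hx : x ≠ 0) : 0 < x ⬝ᵥ x := by
  have h := dotProduct_self_star_pos_iff.2 hx
  simpa using h

lemma dot_nonneg {d : ℕ} (x : Fin d → ℝ) : 0 ≤ x ⬝ᵥ x := by
  have h := dotProduct_self_star_nonneg x
  simpa using h

lemma dot_eq_zero {d : ℕ} {x : Fin d → ℝ} (hx : x ⬝ᵥ x = 0) : x = 0 :=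
  dotProduct_self_eq_zero.1 hx

lemma symm_dot {d : ℕ} {g : Matrix (Fin d) (Fin d) ℝ} (h : gᵀ = g) (x y : Fin d → ℝ) :
    (g *ᵥ x) ⬝ᵥ y = x ⬝ᵥ (g *ᵥ y) := by
  rw [Matrix.dotProduct_mulVec, ← Matrix.mulVec_transpose, h]

lemma tr_vv {d : ℕ} (A : Matrix (Fin d) (Fin d) ℝ) (v : Fin d → ℝ) :
    trace (A * vecMulVec v v) = v ⬝ᵥ A *ᵥ v := by
  rw [Matrix.mul_vecMulVec, Matrix.trace_vecMulVec, dotProduct_comm]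

lemma lyap {d : ℕ} {P Z : Matrix (Fin d) (Fin d) ℝ} (hP : P.PosDef) (hZ : Zᵀ = Z)
    (h : Z * P + P * Z = 0) : Z = 0 := by
  have h1 : trace (Z * P * Z) = 0 := by
    have e1 : trace (Z * P * Z) = trace (P * Z * Z) := by
      rw [Matrix.trace_mul_comm, ← Matrix.mul_assoc, Matrix.trace_mul_comm, ← Matrix.mul_assoc]
    have e2 : trace ((Z * P + P * Z) * Z) = 0 := by rw [h]; simp
    rw [Matrix.add_mul, Matrix.trace_add] at e2
    linarith
  have h2 : trace (Z * P * Z) = ∑ i, (Z i) ⬝ᵥ P *ᵥ (Z i) := by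
    unfold Matrix.trace
    refine Finset.sum_congr rfl fun i _ => ?_
    rw [Matrix.diag_apply, Matrix.mul_assoc, Matrix.mul_apply, dotProduct]
    refine Finset.sum_congr rfl fun j _ => ?_
    congr 1
    rw [Matrix.mul_apply, Matrix.mulVec, dotProduct]
    refine Finset.sum_congr rfl fun k _ => ?_
    congr 1
    conv_lhs => rw [← hZ]
    rfl
  rw [h2] at h1
  have hnn : ∀ i ∈ Finset.univ, 0 ≤ (Z i) ⬝ᵥ P *ᵥ (Z i) := by
    intro i _
    by_cases hi : Z i = 0
    · rw [hi]; simp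
    · exact (pd_pos hP hi).le
  rw [Finset.sum_eq_zero_iff_of_nonneg hnn] at h1
  ext i j
  by_contra hij
  have hi : Z i ≠ 0 := fun h0 => hij (by rw [h0]; rfl)
  exact (pd_pos hP hi).ne' (h1 i (Finset.mem_univ i))

lemma scalar_of_eig {N d : ℕ} (i0 : Fin N) {v : Fin N → Fin d → ℝ} {w : Fin N → ℝ} {c : ℝ}
    (hc : c ≠ 0)
    (ht : ∑ n, w n • vecMulVec (v n) (v n) = c • (1 : Matrix (Fin d) (Fin d) ℝ))
    (hconn : Conn v) {X : Matrix (Fin d) (Fin d) ℝ} (hX : Xᵀ = X) {μ : Fin N → ℝ}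
    (h : ∀ n, X *ᵥ v n = μ n • v n) : X = μ i0 • (1 : Matrix (Fin d) (Fin d) ℝ) := by
  have hall : ∀ n, μ n = μ i0 := by
    by_contra hne
    push Not at hne
    obtain ⟨j0, hj0⟩ := hne
    obtain ⟨i, hi, j, hj, hij⟩ := hconn {n | μ n = μ i0} ⟨i0, rfl⟩ ⟨j0, hj0⟩
    apply hij
    have e := symm_dot hX (v i) (v j)
    rw [h i, h j, smul_dotProduct, dotProduct_smul, smul_eq_mul, smul_eq_mul, hi] at e
    have hj' : μ i0 - μ j ≠ 0 := fun h0 => hj (by change _ = _; linarith)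
    have : (μ i0 - μ j) * (v i ⬝ᵥ v j) = 0 := by linarith
    exact (mul_eq_zero.1 this).resolve_left hj'
  have e : X * (∑ n, w n • vecMulVec (v n) (v n)) = μ i0 • ∑ n, w n • vecMulVec (v n) (v n) := by
    rw [Finset.mul_sum, Finset.smul_sum]
    refine Finset.sum_congr rfl fun n _ => ?_
    rw [Matrix.mul_smul, Matrix.mul_vecMulVec, h n, hall n, Matrix.smul_vecMulVec, smul_comm]
  rw [ht, Matrix.mul_smul, Matrix.mul_one, smul_comm] at e
  exact smul_right_injective _ hc e

lemma eig_of_sum {N d : ℕ} {v : Fin N → Fin d → ℝ} {w a : Fin N → ℝ}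
    (ha : ∀ n, 0 < a n) (hw : ∀ n, w n * (v n ⬝ᵥ v n) = 1)
    {S : Matrix (Fin d) (Fin d) ℝ}
    (h : ∑ n, a n * ((S *ᵥ v n) ⬝ᵥ (S *ᵥ v n) - w n * (v n ⬝ᵥ S *ᵥ v n) ^ 2) = 0) (n : Fin N) :
    S *ᵥ v n = (w n * (v n ⬝ᵥ S *ᵥ v n)) • v n := by
  have key : ∀ n, (S *ᵥ v n) ⬝ᵥ (S *ᵥ v n) - w n * (v n ⬝ᵥ S *ᵥ v n) ^ 2 =
      (S *ᵥ v n - (w n * (v n ⬝ᵥ S *ᵥ v n)) • v n) ⬝ᵥ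
      (S *ᵥ v n - (w n * (v n ⬝ᵥ S *ᵥ v n)) • v n) := by
    intro n
    simp only [sub_dotProduct, dotProduct_sub, smul_dotProduct, dotProduct_smul, smul_eq_mul]
    rw [dotProduct_comm (S *ᵥ v n) (v n)]
    linear_combination (- w n * (v n ⬝ᵥ S *ᵥ v n) ^ 2) * hw n
  have hnn : ∀ n ∈ Finset.univ,
      0 ≤ a n * ((S *ᵥ v n) ⬝ᵥ (S *ᵥ v n) - w n * (v n ⬝ᵥ S *ᵥ v n) ^ 2) := by
    intro n _
    rw [key]
    exact mul_nonneg (ha n).le (dot_nonneg _)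
  rw [Finset.sum_eq_zero_iff_of_nonneg hnn] at h
  have h1 := (mul_eq_zero.1 (h n (Finset.mem_univ n))).resolve_left (ha n).ne'
  rw [key] at h1
  exact sub_eq_zero.1 (dot_eq_zero h1)

lemma pd_mulVec_ne {d : ℕ} {g : Matrix (Fin d) (Fin d) ℝ} (h : g.PosDef) {x : Fin d → ℝ}
    (hx : x ≠ 0) : g *ᵥ x ≠ 0 := by
  intro h0
  have := pd_pos h hx
  rw [h0] at this
  simp at this

lemma Sol.rr_pos {N d : ℕ} {f : Fin N → Fin d → ℝ} {g : Matrix (Fin d) (Fin d) ℝ}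
    (h : Sol f g) (n : Fin N) : 0 < rr g f n :=
  dot_pos (pd_mulVec_ne h.pos (h.ne n))

lemma sum_tr {N d : ℕ} {v : Fin N → Fin d → ℝ} {w : Fin N → ℝ} {c : ℝ}
    (ht : ∑ n, w n • vecMulVec (v n) (v n) = c • (1 : Matrix (Fin d) (Fin d) ℝ))
    (A : Matrix (Fin d) (Fin d) ℝ) : ∑ n, w n * (v n ⬝ᵥ A *ᵥ v n) = c * A.trace := by
  have e : trace (A * ∑ n, w n • vecMulVec (v n) (v n)) = c * A.trace := by
    rw [ht]; simp
  rw [← e, Finset.mul_sum, Matrix.trace_sum]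
  refine Finset.sum_congr rfl fun n _ => ?_
  rw [Matrix.mul_smul, Matrix.trace_smul, tr_vv, smul_eq_mul]

lemma sol_unique {N d : ℕ} (i0 : Fin N) (hd : 0 < d) {f : Fin N → Fin d → ℝ}
    {g₁ g₂ : Matrix (Fin d) (Fin d) ℝ} (h₁ : Sol f g₁) (h₂ : Sol f g₂) : g₁ = g₂ := by
  have hN : 0 < N := i0.pos
  have hc : ((N : ℝ) / d) ≠ 0 := by positivity
  have hu : IsUnit g₁.det := (Matrix.isUnit_iff_isUnit_det _).1 h₁.pos.isUnit
  have s1 := pd_symm h₁.pos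
  have s2 := pd_symm h₂.pos
  set k := g₂ * g₁⁻¹ with hk
  have hkT : kᵀ = g₁⁻¹ * g₂ := by
    rw [hk, Matrix.transpose_mul, s2, Matrix.transpose_nonsing_inv, s1]
  set B := kᵀ * k with hB
  have hBs : Bᵀ = B := by rw [hB, Matrix.transpose_mul, Matrix.transpose_transpose]
  have hkv : ∀ n, k *ᵥ (g₁ *ᵥ f n) = g₂ *ᵥ f n := by
    intro n
    rw [Matrix.mulVec_mulVec, hk, Matrix.mul_assoc, Matrix.nonsing_inv_mul _ hu, Matrix.mul_one]
  have hBv : ∀ x, B *ᵥ x = kᵀ *ᵥ (k *ᵥ x) := fun x => (Matrix.mulVec_mulVec _ _ _).symm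
  have hkk : ∀ x, (k * kᵀ) *ᵥ x = k *ᵥ (kᵀ *ᵥ x) := fun x => (Matrix.mulVec_mulVec _ _ _).symm
  have hr2 : ∀ n, rr g₂ f n = (g₁ *ᵥ f n) ⬝ᵥ B *ᵥ (g₁ *ᵥ f n) := by
    intro n
    rw [rr, ← hkv, hBv, Matrix.dotProduct_mulVec _ kᵀ,
      ← Matrix.mulVec_transpose, Matrix.transpose_transpose]
  have e1 := sum_tr h₁.tight B
  have e2 := sum_tr h₂.tight (k * kᵀ)
  have e3 : ∀ n, (g₂ *ᵥ f n) ⬝ᵥ (k * kᵀ) *ᵥ (g₂ *ᵥ f n) =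
      (B *ᵥ (g₁ *ᵥ f n)) ⬝ᵥ (B *ᵥ (g₁ *ᵥ f n)) := by
    intro n
    rw [hBv, hkv, hkk, Matrix.dotProduct_mulVec _ k, ← Matrix.mulVec_transpose]
  rw [Matrix.trace_mul_comm, ← hB, ← e1] at e2
  have h0 : ∑ n, (rr g₂ f n)⁻¹ * ((B *ᵥ (g₁ *ᵥ f n)) ⬝ᵥ (B *ᵥ (g₁ *ᵥ f n)) -
      (rr g₁ f n)⁻¹ * ((g₁ *ᵥ f n) ⬝ᵥ B *ᵥ (g₁ *ᵥ f n)) ^ 2) = 0 := by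
    rw [← sub_eq_zero, ← Finset.sum_sub_distrib] at e2
    rw [← e2]
    refine Finset.sum_congr rfl fun n _ => ?_
    rw [e3, ← hr2]
    have := (h₂.rr_pos n).ne'
    field_simp
  have heig := eig_of_sum (fun n => inv_pos.2 (h₂.rr_pos n))
    (fun n => inv_mul_cancel₀ (h₁.rr_pos n).ne') h0
  obtain ⟨lam, hlam⟩ : ∃ l, l = (rr g₁ f i0)⁻¹ * ((g₁ *ᵥ f i0) ⬝ᵥ B *ᵥ (g₁ *ᵥ f i0)) := ⟨_, rfl⟩
  have hsc : B = lam • (1 : Matrix (Fin d) (Fin d) ℝ) := by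
    rw [hlam]
    exact scalar_of_eig i0 hc h₁.tight h₁.conn hBs heig
  have hl : 0 < lam := by
    rw [hlam, ← hr2]
    exact mul_pos (inv_pos.2 (h₁.rr_pos _)) (h₂.rr_pos _)
  have hsq : g₂ * g₂ = lam • (g₁ * g₁) := by
    have : g₁ * B * g₁ = g₂ * g₂ := by
      rw [hB, hkT, hk]
      calc g₁ * (g₁⁻¹ * g₂ * (g₂ * g₁⁻¹)) * g₁ = (g₁ * g₁⁻¹) * g₂ * g₂ * (g₁⁻¹ * g₁) := by
            simp only [Matrix.mul_assoc]
        _ = g₂ * g₂ := by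
            rw [Matrix.mul_nonsing_inv _ hu, Matrix.nonsing_inv_mul _ hu, Matrix.one_mul,
              Matrix.mul_one]
    rw [← this, hsc]
    simp
  have hs : Real.sqrt lam * Real.sqrt lam = lam := Real.mul_self_sqrt hl.le
  have hsp : 0 < Real.sqrt lam := Real.sqrt_pos.2 hl
  have hz : g₂ - Real.sqrt lam • g₁ = 0 := by
    refine lyap (P := g₂ + Real.sqrt lam • g₁) (h₂.pos.add (h₁.pos.smul hsp)) ?_ ?_
    · rw [Matrix.transpose_sub, Matrix.transpose_smul, s1, s2]
    · have : Real.sqrt lam • g₁ * Real.sqrt lam • g₁ = g₂ * g₂ := by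
        rw [hsq, Matrix.smul_mul, Matrix.mul_smul, smul_smul, hs]
      simp only [Matrix.add_mul, Matrix.sub_mul, Matrix.mul_add, Matrix.mul_sub, this]
      abel
  have ht : g₂.trace = Real.sqrt lam * g₁.trace := by
    rw [sub_eq_zero.1 hz]; simp
  rw [h₁.tr, h₂.tr] at ht
  have hdp : (0 : ℝ) < d := by exact_mod_cast hd
  have h1 : Real.sqrt lam = 1 := by
    have : (Real.sqrt lam - 1) * d = 0 := by linarith
    rcases mul_eq_zero.1 this with h | h
    · linarith
    · exact absurd h hdp.ne'
  rw [h1, one_smul] at hz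
  exact (sub_eq_zero.1 hz).symm

/-- The equation whose zeros are the solutions. -/
def GG {N d : ℕ} (u : (Fin N → Fin d → ℝ) × Matrix (Fin d) (Fin d) ℝ) :
    Matrix (Fin d) (Fin d) ℝ :=
  TT u.2 u.1 - ((N : ℝ) / d) • (1 : Matrix (Fin d) (Fin d) ℝ) + (u.2 - u.2ᵀ) +
    (u.2.trace - d) • (1 : Matrix (Fin d) (Fin d) ℝ)

/-- derivative of `TT` in direction `Y`. -/
def KK {N d : ℕ} (g : Matrix (Fin d) (Fin d) ℝ) (f : Fin N → Fin d → ℝ)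
    (Y : Matrix (Fin d) (Fin d) ℝ) : Matrix (Fin d) (Fin d) ℝ :=
  ∑ n, ((rr g f n)⁻¹ • (vecMulVec (Y *ᵥ f n) (g *ᵥ f n) + vecMulVec (g *ᵥ f n) (Y *ᵥ f n)) -
    (2 * ((g *ᵥ f n) ⬝ᵥ (Y *ᵥ f n)) * ((rr g f n)⁻¹) ^ 2) • vecMulVec (g *ᵥ f n) (g *ᵥ f n))

lemma trace_TT {N d : ℕ} {g : Matrix (Fin d) (Fin d) ℝ} {f : Fin N → Fin d → ℝ}
    (h : ∀ n, rr g f n ≠ 0) : (TT g f).trace = N := by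
  rw [TT, Matrix.trace_sum]
  have : ∀ n ∈ Finset.univ, ((rr g f n)⁻¹ • vecMulVec (g *ᵥ f n) (g *ᵥ f n)).trace = 1 := by
    intro n _
    rw [Matrix.trace_smul, Matrix.trace_vecMulVec, smul_eq_mul]
    exact inv_mul_cancel₀ (h n)
  rw [Finset.sum_congr rfl this]
  simp

lemma TT_symm {N d : ℕ} (g : Matrix (Fin d) (Fin d) ℝ) (f : Fin N → Fin d → ℝ) :
    (TT g f)ᵀ = TT g f := by
  rw [TT, Matrix.transpose_sum]
  refine Finset.sum_congr rfl fun n _ => ?_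
  rw [Matrix.transpose_smul, Matrix.transpose_vecMulVec]

/-- zeros of `GG` -/
lemma GG_eq_zero {N d : ℕ} (hd : 0 < d) {g : Matrix (Fin d) (Fin d) ℝ} {f : Fin N → Fin d → ℝ}
    (h : ∀ n, rr g f n ≠ 0) (h0 : GG (f, g) = 0) :
    gᵀ = g ∧ g.trace = d ∧ TT g f = ((N : ℝ) / d) • (1 : Matrix (Fin d) (Fin d) ℝ) := by
  have hdp : (d : ℝ) ≠ 0 := by positivity
  have h1 : (GG (f, g))ᵀ = 0 := by rw [h0, Matrix.transpose_zero]
  simp only [GG] at h0 h1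
  have hs : gᵀ = g := by
    simp only [Matrix.transpose_add, Matrix.transpose_sub, Matrix.transpose_smul,
      Matrix.transpose_one, Matrix.transpose_transpose, TT_symm] at h1
    have : (2 : ℝ) • (g - gᵀ) = 0 := by
      rw [two_smul]
      have := congrArg₂ (· - ·) h0 h1
      simp only [sub_zero] at this
      rw [← this]
      abel
    have h2 := (smul_eq_zero.1 this).resolve_left two_ne_zero
    exact (sub_eq_zero.1 h2).symm
  rw [hs] at h0
  have ht : g.trace = d := by
    have := congrArg Matrix.trace h0
    simp only [Matrix.trace_add, Matrix.trace_sub, Matrix.trace_smul, trace_TT h, Matrix.trace_one,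
      Fintype.card_fin, smul_eq_mul, Matrix.trace_zero] at this
    have h3 : (g.trace - d) * d = 0 := by
      have : (N : ℝ) / d * d = N := by field_simp
      linarith
    rcases mul_eq_zero.1 h3 with h | h
    · linarith
    · exact absurd h hdp
  refine ⟨hs, ht, ?_⟩
  rw [ht] at h0
  simpa [sub_eq_zero] using h0

lemma deriv_inj {N d : ℕ} (i0 : Fin N) (hd : 0 < d) {f : Fin N → Fin d → ℝ}
    {g : Matrix (Fin d) (Fin d) ℝ} (h : Sol f g) {Y : Matrix (Fin d) (Fin d) ℝ}
    (hY : KK g f Y + (Y - Yᵀ) + Y.trace • (1 : Matrix (Fin d) (Fin d) ℝ) = 0) : Y = 0 := by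
  have hN : 0 < N := i0.pos
  have hdp : (d : ℝ) ≠ 0 := by positivity
  have hc : ((N : ℝ) / d) ≠ 0 := by positivity
  have hu : IsUnit g.det := (Matrix.isUnit_iff_isUnit_det _).1 h.pos.isUnit
  have sg := pd_symm h.pos
  have hKs : (KK g f Y)ᵀ = KK g f Y := by
    rw [KK, Matrix.transpose_sum]
    refine Finset.sum_congr rfl fun n _ => ?_
    rw [Matrix.transpose_sub, Matrix.transpose_smul, Matrix.transpose_smul, Matrix.transpose_add,
      Matrix.transpose_vecMulVec, Matrix.transpose_vecMulVec, Matrix.transpose_vecMulVec, add_comm]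
  have hKt : (KK g f Y).trace = 0 := by
    rw [KK, Matrix.trace_sum]
    refine Finset.sum_eq_zero fun n _ => ?_
    rw [Matrix.trace_sub, Matrix.trace_smul, Matrix.trace_smul, Matrix.trace_add,
      Matrix.trace_vecMulVec, Matrix.trace_vecMulVec, Matrix.trace_vecMulVec, smul_eq_mul,
      smul_eq_mul, dotProduct_comm (Y *ᵥ f n)]
    have h1 := (h.rr_pos n).ne'
    change _ - _ * rr g f n = 0
    field_simp
    ring
  have hYs : Yᵀ = Y := by
    have h1 : (KK g f Y + (Y - Yᵀ) + Y.trace • (1 : Matrix (Fin d) (Fin d) ℝ))ᵀ = 0 := by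
      rw [hY, Matrix.transpose_zero]
    simp only [Matrix.transpose_add, Matrix.transpose_sub, Matrix.transpose_smul,
      Matrix.transpose_one, Matrix.transpose_transpose, hKs] at h1
    have : (2 : ℝ) • (Y - Yᵀ) = 0 := by
      rw [two_smul]
      have := congrArg₂ (· - ·) hY h1
      simp only [sub_zero] at this
      rw [← this]
      abel
    have h2 := (smul_eq_zero.1 this).resolve_left two_ne_zero
    exact (sub_eq_zero.1 h2).symm
  rw [hYs, sub_self, add_zero] at hY
  have hYt : Y.trace = 0 := by
    have := congrArg Matrix.trace hY
    simp only [Matrix.trace_add, hKt, Matrix.trace_smul, Matrix.trace_one,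
      Fintype.card_fin, smul_eq_mul, Matrix.trace_zero, zero_add] at this
    exact (mul_eq_zero.1 this).resolve_right hdp
  rw [hYt, zero_smul, add_zero] at hY
  obtain ⟨X, hX⟩ : ∃ X, X = Y * g⁻¹ := ⟨_, rfl⟩
  have hXv : ∀ n, Y *ᵥ f n = X *ᵥ (g *ᵥ f n) := by
    intro n
    rw [Matrix.mulVec_mulVec, hX, Matrix.mul_assoc, Matrix.nonsing_inv_mul _ hu, Matrix.mul_one]
  obtain ⟨S, hS⟩ : ∃ S, S = (1 / 2 : ℝ) • (X + Xᵀ) := ⟨_, rfl⟩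
  have hSs : Sᵀ = S := by
    rw [hS, Matrix.transpose_smul, Matrix.transpose_add, Matrix.transpose_transpose, add_comm]
  have hquad : ∀ v : Fin d → ℝ, v ⬝ᵥ X *ᵥ v = v ⬝ᵥ S *ᵥ v := by
    intro v
    have : v ⬝ᵥ Xᵀ *ᵥ v = v ⬝ᵥ X *ᵥ v := by
      rw [Matrix.mulVec_transpose, dotProduct_comm, ← Matrix.dotProduct_mulVec]
    rw [hS, Matrix.smul_mulVec, Matrix.add_mulVec, dotProduct_smul, dotProduct_add, this,
      smul_eq_mul]
    ring
  have hK2 : KK g f Y = X * TT g f + TT g f * Xᵀ -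
      ∑ n, (2 * ((g *ᵥ f n) ⬝ᵥ S *ᵥ (g *ᵥ f n)) * ((rr g f n)⁻¹) ^ 2) •
        vecMulVec (g *ᵥ f n) (g *ᵥ f n) := by
    rw [KK, TT, Finset.mul_sum, Finset.sum_mul, ← Finset.sum_add_distrib,
      ← Finset.sum_sub_distrib]
    refine Finset.sum_congr rfl fun n _ => ?_
    rw [hXv, hquad, Matrix.mul_smul, Matrix.smul_mul, Matrix.mul_vecMulVec, Matrix.vecMulVec_mul,
      ← smul_add, Matrix.vecMul_transpose]
  rw [h.tight, hY] at hK2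
  have hK3 : ((N : ℝ) / d) • S = ∑ n, (((g *ᵥ f n) ⬝ᵥ S *ᵥ (g *ᵥ f n)) * ((rr g f n)⁻¹) ^ 2) •
        vecMulVec (g *ᵥ f n) (g *ᵥ f n) := by
    have e : ∑ n, (2 * ((g *ᵥ f n) ⬝ᵥ S *ᵥ (g *ᵥ f n)) * ((rr g f n)⁻¹) ^ 2) •
        vecMulVec (g *ᵥ f n) (g *ᵥ f n) = (2 : ℝ) •
        ∑ n, (((g *ᵥ f n) ⬝ᵥ S *ᵥ (g *ᵥ f n)) * ((rr g f n)⁻¹) ^ 2) •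
        vecMulVec (g *ᵥ f n) (g *ᵥ f n) := by
      rw [Finset.smul_sum]
      refine Finset.sum_congr rfl fun n _ => ?_
      rw [smul_smul, mul_assoc]
    rw [e, Matrix.mul_smul, Matrix.smul_mul, Matrix.mul_one, Matrix.one_mul, eq_comm,
      sub_eq_zero] at hK2
    have e2 : X + Xᵀ = (2 : ℝ) • S := by rw [hS, smul_smul]; norm_num
    rw [← smul_add, e2, smul_comm] at hK2
    exact smul_right_injective _ (two_ne_zero (α := ℝ)) hK2
  have e1 := sum_tr h.tight (S * S)
  have e2 := congrArg (fun M => (S * M).trace) hK3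
  simp only [Finset.mul_sum, Matrix.mul_smul, Matrix.trace_sum, Matrix.trace_smul, tr_vv,
    smul_eq_mul] at e2
  rw [e2] at e1
  have h0 : ∑ n, (rr g f n)⁻¹ * ((S *ᵥ (g *ᵥ f n)) ⬝ᵥ (S *ᵥ (g *ᵥ f n)) -
      (rr g f n)⁻¹ * ((g *ᵥ f n) ⬝ᵥ S *ᵥ (g *ᵥ f n)) ^ 2) = 0 := by
    rw [← sub_eq_zero, ← Finset.sum_sub_distrib] at e1
    rw [← e1]
    refine Finset.sum_congr rfl fun n _ => ?_
    have : (g *ᵥ f n) ⬝ᵥ (S * S) *ᵥ (g *ᵥ f n) = (S *ᵥ (g *ᵥ f n)) ⬝ᵥ (S *ᵥ (g *ᵥ f n)) := by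
      rw [symm_dot hSs, ← Matrix.mulVec_mulVec (M := S) (N := S)]
    rw [this]
    ring
  have heig := eig_of_sum (fun n => inv_pos.2 (h.rr_pos n))
    (fun n => inv_mul_cancel₀ (h.rr_pos n).ne') h0
  obtain ⟨μ, hμ⟩ : ∃ l, l = (rr g f i0)⁻¹ * ((g *ᵥ f i0) ⬝ᵥ S *ᵥ (g *ᵥ f i0)) := ⟨_, rfl⟩
  have hsc : S = μ • (1 : Matrix (Fin d) (Fin d) ℝ) := by
    rw [hμ]
    exact scalar_of_eig i0 hc h.tight h.conn hSs heig
  have hXX : X + Xᵀ = (2 * μ) • (1 : Matrix (Fin d) (Fin d) ℝ) := by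
    rw [← smul_smul, ← hsc, hS, smul_smul]; norm_num
  have hXT : Xᵀ = g⁻¹ * Y := by
    rw [hX, Matrix.transpose_mul, hYs, Matrix.transpose_nonsing_inv, sg]
  have hz : Y - μ • g = 0 := by
    refine lyap (P := g⁻¹) h.pos.inv ?_ ?_
    · rw [Matrix.transpose_sub, Matrix.transpose_smul, sg, hYs]
    · rw [Matrix.sub_mul, Matrix.mul_sub, Matrix.smul_mul, Matrix.mul_smul,
        Matrix.nonsing_inv_mul _ hu, Matrix.mul_nonsing_inv _ hu, ← hX, ← hXT]
      have : X - μ • (1 : Matrix (Fin d) (Fin d) ℝ) + (Xᵀ - μ • 1) =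
        X + Xᵀ - (2 * μ) • (1 : Matrix (Fin d) (Fin d) ℝ) := by
        rw [two_mul, add_smul]; abel
      rw [this, hXX, sub_self]
  have ht := congrArg Matrix.trace hz
  rw [Matrix.trace_sub, Matrix.trace_smul, h.tr, hYt, Matrix.trace_zero, smul_eq_mul] at ht
  have hμ0 : μ = 0 := by
    have : μ * d = 0 := by linarith
    exact (mul_eq_zero.1 this).resolve_right hdp
  rw [hμ0, zero_smul, sub_zero] at hz
  exact hz

/-- `GG` on plain function spaces. -/
def GP {N d : ℕ} (u : (Fin N → Fin d → ℝ) × (Fin d → Fin d → ℝ)) : Fin d → Fin d → ℝ :=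
  fun a b => GG (u.1, Matrix.of u.2) a b

lemma contDiff_mulVec {N d : ℕ} (n : Fin N) (a : Fin d) :
    ContDiff ℝ ω (fun u : (Fin N → Fin d → ℝ) × (Fin d → Fin d → ℝ) =>
      (Matrix.of u.2 *ᵥ u.1 n) a) := by
  simp only [Matrix.mulVec, dotProduct, Matrix.of_apply]
  fun_prop

lemma contDiff_rr {N d : ℕ} (n : Fin N) :
    ContDiff ℝ ω (fun u : (Fin N → Fin d → ℝ) × (Fin d → Fin d → ℝ) =>
      rr (Matrix.of u.2) u.1 n) := by
  unfold rr
  simp only [dotProduct]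
  refine ContDiff.sum fun j _ => ?_
  exact (contDiff_mulVec n j).mul (contDiff_mulVec n j)

lemma contDiffAt_GG {N d : ℕ} {u : (Fin N → Fin d → ℝ) × (Fin d → Fin d → ℝ)}
    (h : ∀ n, rr (Matrix.of u.2) u.1 n ≠ 0) : ContDiffAt ℝ ω GP u := by
  refine contDiffAt_pi.2 fun a => contDiffAt_pi.2 fun b => ?_
  have e : (fun u : (Fin N → Fin d → ℝ) × (Fin d → Fin d → ℝ) => GP u a b) = fun u =>
      ∑ n, (rr (Matrix.of u.2) u.1 n)⁻¹ *
        ((Matrix.of u.2 *ᵥ u.1 n) a * (Matrix.of u.2 *ᵥ u.1 n) b) -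
        ((N : ℝ) / d) * (1 : Matrix (Fin d) (Fin d) ℝ) a b + (u.2 a b - u.2 b a) +
        (∑ i, u.2 i i - d) * (1 : Matrix (Fin d) (Fin d) ℝ) a b := by
    funext u
    simp [GP, GG, TT, Matrix.sum_apply, vecMulVec_apply, Matrix.trace]
  rw [e]
  refine ContDiffAt.add (ContDiffAt.add (ContDiffAt.sub ?_ contDiffAt_const) ?_) ?_
  · refine ContDiffAt.sum fun n _ => ?_
    refine ContDiffAt.mul ((contDiff_rr n).contDiffAt.inv (h n)) ?_
    exact ((contDiff_mulVec n a).mul (contDiff_mulVec n b)).contDiffAt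
  · fun_prop
  · fun_prop

lemma hasDerivAt_GG {N d : ℕ} {f : Fin N → Fin d → ℝ} {g : Matrix (Fin d) (Fin d) ℝ}
    (h : ∀ n, rr g f n ≠ 0) (Y : Matrix (Fin d) (Fin d) ℝ) (a b : Fin d) :
    HasDerivAt (fun s : ℝ => GG (f, g + s • Y) a b)
      ((KK g f Y + (Y - Yᵀ) + Y.trace • (1 : Matrix (Fin d) (Fin d) ℝ)) a b) 0 := by
  have hv : ∀ n a, HasDerivAt (fun s : ℝ => ((g + s • Y) *ᵥ f n) a) ((Y *ᵥ f n) a) 0 := by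
    intro n a
    have e : (fun s : ℝ => ((g + s • Y) *ᵥ f n) a) =
        fun s => (g *ᵥ f n) a + s * (Y *ᵥ f n) a := by
      funext s; simp [Matrix.add_mulVec, Matrix.smul_mulVec]
    rw [e]
    simpa using ((hasDerivAt_id (0 : ℝ)).mul_const ((Y *ᵥ f n) a)).const_add ((g *ᵥ f n) a)
  have hr : ∀ n, HasDerivAt (fun s : ℝ => rr (g + s • Y) f n)
      (2 * ((g *ᵥ f n) ⬝ᵥ (Y *ᵥ f n))) 0 := by
    intro n
    have := HasDerivAt.fun_sum (u := Finset.univ) fun i _ => (hv n i).mul (hv n i)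
    convert! this using 1
    simp only [zero_smul, add_zero, dotProduct, Finset.mul_sum]
    refine Finset.sum_congr rfl fun i _ => ?_
    ring
  have e : (fun s : ℝ => GG (f, g + s • Y) a b) = fun s =>
      ∑ n, (rr (g + s • Y) f n)⁻¹ * (((g + s • Y) *ᵥ f n) a * ((g + s • Y) *ᵥ f n) b) -
        ((N : ℝ) / d) * (1 : Matrix (Fin d) (Fin d) ℝ) a b + (g a b - g b a + s * (Y a b - Y b a)) +
        (g.trace - d + s * Y.trace) * (1 : Matrix (Fin d) (Fin d) ℝ) a b := by
    funext s
    simp only [GG, TT, Matrix.sum_apply, vecMulVec_apply, Matrix.add_apply, Matrix.sub_apply,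
      Matrix.smul_apply, Matrix.trace_add, Matrix.trace_smul, smul_eq_mul, Matrix.transpose_apply]
    ring
  rw [e]
  have hlin : ∀ p q : ℝ, HasDerivAt (fun s : ℝ => p + s * q) q 0 := by
    intro p q
    simpa using ((hasDerivAt_id (0 : ℝ)).mul_const q).const_add p
  have hsum := HasDerivAt.fun_sum (u := Finset.univ) fun n _ =>
    ((hr n).inv (by simpa using h n)).mul ((hv n a).mul (hv n b))
  have := ((hsum.sub_const (((N : ℝ) / d) * (1 : Matrix (Fin d) (Fin d) ℝ) a b)).add
    (hlin (g a b - g b a) (Y a b - Y b a))).add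
    ((hlin (g.trace - d) Y.trace).mul_const ((1 : Matrix (Fin d) (Fin d) ℝ) a b))
  convert! this using 1
  simp only [KK, Matrix.sum_apply, vecMulVec_apply, Matrix.add_apply, Matrix.sub_apply,
      Matrix.smul_apply, smul_eq_mul, Matrix.transpose_apply, zero_smul, add_zero]
  congr 2
  refine Finset.sum_congr rfl fun n _ => ?_
  simp only [Pi.inv_apply, Pi.mul_apply, zero_smul, add_zero]
  have := h n
  field_simp
  ring

lemma exists_implicit {N d : ℕ} (i0 : Fin N) (hd : 0 < d) {f : Fin N → Fin d → ℝ}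
    {g : Fin d → Fin d → ℝ} (h : Sol f (Matrix.of g)) :
    ∃ γ : (Fin N → Fin d → ℝ) → (Fin d → Fin d → ℝ), ContDiffAt ℝ ω γ f ∧ γ f = g ∧
      ∀ᶠ x in 𝓝 f, GG (x, Matrix.of (γ x)) = 0 := by
  have hr : ∀ n, rr (Matrix.of g) f n ≠ 0 := fun n => (h.rr_pos n).ne'
  have hG : GP (f, g) = 0 := by
    funext a b
    have : GG (f, Matrix.of g) = 0 := by
      simp [GG, h.tight, pd_symm h.pos, h.tr]
    simp [GP, this]
  have cd : ContDiffAt ℝ ω (GP (N := N) (d := d)) (f, g) := contDiffAt_GG hr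
  have hinj : Function.Injective (fderiv ℝ (GP (N := N) (d := d)) (f, g) ∘L
      .inr ℝ (Fin N → Fin d → ℝ) (Fin d → Fin d → ℝ)) := by
    rw [injective_iff_map_eq_zero]
    intro Y hY
    have hline : HasDerivAt
        (fun s : ℝ => ((f, g + s • Y) : (Fin N → Fin d → ℝ) × (Fin d → Fin d → ℝ)))
        (0, Y) 0 := by
      refine HasDerivAt.prodMk (hasDerivAt_const _ _) ?_
      simpa using ((hasDerivAt_id (0 : ℝ)).smul_const Y).const_add g
    have hd2 : HasFDerivAt (GP (N := N) (d := d)) (fderiv ℝ (GP (N := N) (d := d)) (f, g))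
        ((fun s : ℝ => ((f, g + s • Y) : (Fin N → Fin d → ℝ) × (Fin d → Fin d → ℝ))) 0) := by
      simpa using (cd.differentiableAt (by simp)).hasFDerivAt
    have hcomp := hd2.comp_hasDerivAt 0 hline
    have hz : fderiv ℝ (GP (N := N) (d := d)) (f, g) (0, Y) = 0 := hY
    rw [hz] at hcomp
    have hY0 : Matrix.of Y = 0 := by
      apply deriv_inj i0 hd h
      ext a b
      refine (hasDerivAt_GG hr (Matrix.of Y) a b).unique ?_
      exact hasDerivAt_pi.1 (hasDerivAt_pi.1 hcomp a) b
    funext a b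
    exact congrFun (congrFun hY0 a) b
  have hinv : (fderiv ℝ (GP (N := N) (d := d)) (f, g) ∘L
      .inr ℝ (Fin N → Fin d → ℝ) (Fin d → Fin d → ℝ)).IsInvertible := by
    set Lm := fderiv ℝ (GP (N := N) (d := d)) (f, g) ∘L
      .inr ℝ (Fin N → Fin d → ℝ) (Fin d → Fin d → ℝ) with hLm
    refine ⟨(LinearEquiv.ofInjectiveEndo
      (Lm : (Fin d → Fin d → ℝ) →ₗ[ℝ] _) hinj).toContinuousLinearEquiv, ?_⟩
    ext x
    rfl
  refine ⟨cd.implicitFunction (by simp) hinv, ?_, ?_, ?_⟩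
  · exact cd.contDiffAt_implicitFunction (by simp) hinv
  · exact cd.implicitFunction_apply_self (by simp) hinv
  · have := cd.eventually_apply_implicitFunction (by simp) hinv
    rw [hG] at this
    filter_upwards [this] with x hx
    ext a b
    exact congrFun (congrFun hx a) b

lemma eventually_pd {d : ℕ} {g : Fin d → Fin d → ℝ} (h : (Matrix.of g).PosDef) :
    ∀ᶠ g' : Fin d → Fin d → ℝ in 𝓝 g, (Matrix.of g')ᵀ = Matrix.of g' → (Matrix.of g').PosDef := by
  have hcont : Continuous (fun z : (Fin d → Fin d → ℝ) × (Fin d → ℝ) =>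
      z.2 ⬝ᵥ (Matrix.of z.1) *ᵥ z.2) := by
    simp only [Matrix.mulVec, dotProduct, Matrix.of_apply]
    fun_prop
  have key : ∀ᶠ g' : Fin d → Fin d → ℝ in 𝓝 g, ∀ y ∈ Metric.sphere (0 : Fin d → ℝ) 1,
      0 < y ⬝ᵥ (Matrix.of g') *ᵥ y := by
    refine (isCompact_sphere (0 : Fin d → ℝ) 1).eventually_forall_of_forall_eventually ?_
    intro y hy
    have hy0 : y ≠ 0 := by
      rintro rfl
      simp at hy
    exact hcont.continuousAt.eventually_const_lt (pd_pos h hy0)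
  filter_upwards [key] with g' hg' hs
  refine pd_of hs fun x hx => ?_
  have hn : 0 < ‖x‖ := norm_pos_iff.2 hx
  have h1 := hg' (‖x‖⁻¹ • x) (by simp [norm_smul, hn.ne'])
  rw [Matrix.mulVec_smul, smul_dotProduct, dotProduct_smul, smul_eq_mul, smul_eq_mul] at h1
  have h2 : 0 < ‖x‖⁻¹ := inv_pos.2 hn
  exact (mul_pos_iff_of_pos_left h2).1 ((mul_pos_iff_of_pos_left h2).1 h1)

lemma eventually_conn {N d : ℕ} {E : Type*} [TopologicalSpace E] {x₀ : E}
    {v : E → Fin N → Fin d → ℝ} (hv : ∀ n a, ContinuousAt (fun x => v x n a) x₀)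
    (h : Conn (v x₀)) : ∀ᶠ x in 𝓝 x₀, Conn (v x) := by
  unfold Conn
  rw [Filter.eventually_all]
  intro S
  by_cases h1 : S.Nonempty
  · by_cases h2 : Sᶜ.Nonempty
    · obtain ⟨i, hi, j, hj, hij⟩ := h S h1 h2
      have hc : ContinuousAt (fun x => v x i ⬝ᵥ v x j) x₀ := by
        simp only [dotProduct]
        exact tendsto_finsetSum _ fun a _ => (hv i a).mul (hv j a)
      filter_upwards [hc.eventually_ne hij] with x hx _ _
      exact ⟨i, hi, j, hj, hx⟩
    · exact Filter.Eventually.of_forall fun x _ h => absurd h h2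
  · exact Filter.Eventually.of_forall fun x h => absurd h h1

lemma eventually_sol {N d : ℕ} (hd : 0 < d) {f : Fin N → Fin d → ℝ}
    {g : Fin d → Fin d → ℝ} (h : Sol f (Matrix.of g))
    {γ : (Fin N → Fin d → ℝ) → (Fin d → Fin d → ℝ)} (hγ : ContinuousAt γ f) (hγf : γ f = g)
    (hG : ∀ᶠ x in 𝓝 f, GG (x, Matrix.of (γ x)) = 0) :
    ∀ᶠ x in 𝓝 f, Sol x (Matrix.of (γ x)) := by
  have hpair : ContinuousAt (fun x => (x, γ x)) f := continuousAt_id.prodMk hγ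
  have hne : ∀ᶠ x : Fin N → Fin d → ℝ in 𝓝 f, ∀ n, x n ≠ 0 := by
    rw [Filter.eventually_all]
    intro n
    exact (continuous_apply n).continuousAt.eventually_ne (h.ne n)
  have hr : ∀ᶠ x : Fin N → Fin d → ℝ in 𝓝 f, ∀ n, rr (Matrix.of (γ x)) x n ≠ 0 := by
    rw [Filter.eventually_all]
    intro n
    have hc : ContinuousAt (fun x => rr (Matrix.of (γ x)) x n) f :=
      ContinuousAt.comp (f := fun x => (x, γ x))
        (g := fun u : (Fin N → Fin d → ℝ) × (Fin d → Fin d → ℝ) => rr (Matrix.of u.2) u.1 n)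
        (contDiff_rr n).continuous.continuousAt hpair
    refine hc.eventually_ne ?_
    rw [hγf]
    exact (h.rr_pos n).ne'
  have hpd : ∀ᶠ x in 𝓝 f, (Matrix.of (γ x))ᵀ = Matrix.of (γ x) → (Matrix.of (γ x)).PosDef := by
    have := eventually_pd h.pos
    rw [← hγf] at this
    exact hγ.eventually this
  have hcn : ∀ᶠ x in 𝓝 f, Conn (fun n => Matrix.of (γ x) *ᵥ x n) := by
    refine eventually_conn (v := fun x n => Matrix.of (γ x) *ᵥ x n) ?_ ?_
    · intro n a
      exact ContinuousAt.comp (f := fun x => (x, γ x))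
        (g := fun u : (Fin N → Fin d → ℝ) × (Fin d → Fin d → ℝ) => (Matrix.of u.2 *ᵥ u.1 n) a)
        (contDiff_mulVec n a).continuous.continuousAt hpair
    · rw [hγf]
      exact h.conn
  filter_upwards [hne, hr, hpd, hcn, hG] with x h1 h2 h3 h4 h5
  obtain ⟨e1, e2, e3⟩ := GG_eq_zero hd h2 h5
  exact ⟨h3 e1, e2, h1, e3, h4⟩

/-- Configurations that can be brought to a connected tight position. -/
def UU (N d : ℕ) : Set (Fin N → Fin d → ℝ) := {f | ∃ g : Fin d → Fin d → ℝ, Sol f (Matrix.of g)}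

open Classical in
/-- the solution -/
def gam {N d : ℕ} (f : Fin N → Fin d → ℝ) : Fin d → Fin d → ℝ :=
  if h : ∃ g : Fin d → Fin d → ℝ, Sol f (Matrix.of g) then h.choose else 0

lemma gam_spec {N d : ℕ} {f : Fin N → Fin d → ℝ} (h : f ∈ UU N d) : Sol f (Matrix.of (gam f)) := by
  have h' : ∃ g : Fin d → Fin d → ℝ, Sol f (Matrix.of g) := h
  rw [gam, dif_pos h']
  exact h'.choose_spec

lemma gam_eq {N d : ℕ} (i0 : Fin N) (hd : 0 < d) {f : Fin N → Fin d → ℝ} {g : Fin d → Fin d → ℝ}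
    (h : Sol f (Matrix.of g)) : gam f = g :=
  Matrix.of.injective (sol_unique i0 hd (gam_spec ⟨g, h⟩) h)

lemma UU_open {N d : ℕ} (i0 : Fin N) (hd : 0 < d) : IsOpen (UU N d) := by
  rw [isOpen_iff_mem_nhds]
  rintro f ⟨g, h⟩
  obtain ⟨γ, h1, h2, h3⟩ := exists_implicit i0 hd h
  filter_upwards [eventually_sol hd h h1.continuousAt h2 h3] with x hx
  exact ⟨_, hx⟩

lemma gam_contDiffAt {N d : ℕ} (i0 : Fin N) (hd : 0 < d) {f : Fin N → Fin d → ℝ}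
    (hf : f ∈ UU N d) : ContDiffAt ℝ ω gam f := by
  obtain ⟨g, h⟩ := hf
  obtain ⟨γ, h1, h2, h3⟩ := exists_implicit i0 hd h
  refine h1.congr_of_eventuallyEq ?_
  filter_upwards [eventually_sol hd h h1.continuousAt h2 h3] with x hx
  exact gam_eq i0 hd hx

/-- retraction to tight frames -/
def Phi {N d : ℕ} (f : Fin N → Fin d → ℝ) : Fin N → Fin d → ℝ :=
  fun n => (Real.sqrt (rr (Matrix.of (gam f)) f n))⁻¹ • (Matrix.of (gam f) *ᵥ f n)

lemma Phi_contDiffAt {N d : ℕ} (i0 : Fin N) (hd : 0 < d) {f : Fin N → Fin d → ℝ}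
    (hf : f ∈ UU N d) : ContDiffAt ℝ ω Phi f := by
  have hpair : ContDiffAt ℝ ω (fun x => (x, gam x)) f :=
    contDiffAt_id.prodMk (gam_contDiffAt i0 hd hf)
  refine contDiffAt_pi.2 fun n => contDiffAt_pi.2 fun a => ?_
  have hr : ContDiffAt ℝ ω (fun x => rr (Matrix.of (gam x)) x n) f :=
    ContDiffAt.comp (f := fun x => (x, gam x))
      (g := fun u : (Fin N → Fin d → ℝ) × (Fin d → Fin d → ℝ) => rr (Matrix.of u.2) u.1 n) f
      (contDiff_rr n).contDiffAt hpair
  have hv : ContDiffAt ℝ ω (fun x => (Matrix.of (gam x) *ᵥ x n) a) f :=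
    ContDiffAt.comp (f := fun x => (x, gam x))
      (g := fun u : (Fin N → Fin d → ℝ) × (Fin d → Fin d → ℝ) => (Matrix.of u.2 *ᵥ u.1 n) a) f
      (contDiff_mulVec n a).contDiffAt hpair
  have hp := (gam_spec hf).rr_pos n
  exact ((hr.sqrt hp.ne').inv (Real.sqrt_pos.2 hp).ne').mul hv

/-- vector form of FUNTF -/
def FU {N d : ℕ} (h : Fin N → Fin d → ℝ) : Prop :=
  ∑ n, vecMulVec (h n) (h n) = ((N : ℝ) / d) • (1 : Matrix (Fin d) (Fin d) ℝ) ∧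
    ∀ n, h n ⬝ᵥ h n = 1

lemma Phi_FU {N d : ℕ} {f : Fin N → Fin d → ℝ} (hf : f ∈ UU N d) : FU (Phi f) := by
  have hs := gam_spec hf
  constructor
  · rw [← hs.tight, TT]
    refine Finset.sum_congr rfl fun n _ => ?_
    have hp := hs.rr_pos n
    rw [Phi, Matrix.smul_vecMulVec, Matrix.vecMulVec_smul, smul_smul, ← mul_inv,
      Real.mul_self_sqrt hp.le]
  · intro n
    have hp := hs.rr_pos n
    rw [Phi, smul_dotProduct, dotProduct_smul, smul_eq_mul, smul_eq_mul, ← mul_assoc, ← mul_inv,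
      Real.mul_self_sqrt hp.le]
    exact inv_mul_cancel₀ hp.ne'

lemma FU_sol {N d : ℕ} {f : Fin N → Fin d → ℝ} (hf : FU f) (hc : Conn f) :
    Sol f (Matrix.of (1 : Matrix (Fin d) (Fin d) ℝ)) := by
  have e : (Matrix.of (1 : Matrix (Fin d) (Fin d) ℝ)) = 1 := rfl
  rw [e]
  refine ⟨Matrix.PosDef.one, by simp, ?_, ?_, by simpa using hc⟩
  · intro n h0
    have := hf.2 n
    rw [h0] at this
    simp at this
  · rw [← hf.1, TT]
    refine Finset.sum_congr rfl fun n _ => ?_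
    rw [rr, Matrix.one_mulVec, hf.2 n]
    simp

lemma FU_Phi {N d : ℕ} (i0 : Fin N) (hd : 0 < d) {f : Fin N → Fin d → ℝ} (hf : FU f)
    (hc : Conn f) : Phi f = f := by
  have := gam_eq i0 hd (FU_sol hf hc)
  funext n
  have e : (Matrix.of (1 : Matrix (Fin d) (Fin d) ℝ)) = 1 := rfl
  rw [Phi, this, e, rr, Matrix.one_mulVec, hf.2 n]
  simp

lemma eval_analyticAt {N d : ℕ} (i0 : Fin N) (hd : 0 < d) (p : MvPolynomial (Fin d × Fin N) ℝ)
    {f : Fin N → Fin d → ℝ} (hf : f ∈ UU N d) :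
    AnalyticAt ℝ (fun x => MvPolynomial.eval (fun v => Phi x v.2 v.1) p) f := by
  have h := (Phi_contDiffAt i0 hd hf)
  have h2 : ∀ v : Fin d × Fin N, AnalyticAt ℝ (fun x => Phi x v.2 v.1) f := by
    intro v
    exact (contDiffAt_pi.1 (contDiffAt_pi.1 h v.2) v.1).analyticAt
  have := AnalyticAt.aeval_mvPolynomial (f := fun x (v : Fin d × Fin N) => Phi x v.2 v.1) h2 p
  simpa [MvPolynomial.aeval_eq_eval] using this

lemma exists_proj {d : ℕ} (W : Submodule ℝ (Fin d → ℝ)) :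
    ∃ P : Matrix (Fin d) (Fin d) ℝ, P.trace = Module.finrank ℝ W ∧
      (∀ x ∈ W, x ⬝ᵥ P *ᵥ x = x ⬝ᵥ x) ∧ (∀ x, 0 ≤ x ⬝ᵥ P *ᵥ x) ∧
      (∀ x, (∀ y ∈ W, y ⬝ᵥ x = 0) → x ⬝ᵥ P *ᵥ x = 0) := by
  let L : EuclideanSpace ℝ (Fin d) ≃ₗ[ℝ] (Fin d → ℝ) := WithLp.linearEquiv 2 ℝ (Fin d → ℝ)
  let W' : Submodule ℝ (EuclideanSpace ℝ (Fin d)) := W.comap L.toLinearMap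
  have hfr : Module.finrank ℝ W' = Module.finrank ℝ W := by
    have : W' = W.map L.symm.toLinearMap := by
      exact (Submodule.map_equiv_eq_comap_symm L.symm W).symm
    rw [this]
    exact LinearEquiv.finrank_map_eq L.symm W
  let b := stdOrthonormalBasis ℝ W'
  let v : Fin (Module.finrank ℝ W') → Fin d → ℝ := fun i => L (b i)
  have hin : ∀ x y : EuclideanSpace ℝ (Fin d), inner ℝ x y = L x ⬝ᵥ L y := by
    intro x y
    rw [EuclideanSpace.inner_eq_star_dotProduct, dotProduct_comm]
    rfl
  have hP : ∀ x, x ⬝ᵥ (∑ i, vecMulVec (v i) (v i)) *ᵥ x = ∑ i, (v i ⬝ᵥ x) ^ 2 := by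
    intro x
    rw [Matrix.sum_mulVec, dotProduct_sum]
    refine Finset.sum_congr rfl fun i _ => ?_
    rw [Matrix.vecMulVec_mulVec, dotProduct_smul]
    simp [dotProduct_comm x, sq]
  refine ⟨∑ i, vecMulVec (v i) (v i), ?_, ?_, ?_, ?_⟩
  · rw [Matrix.trace_sum, ← hfr]
    have : ∀ i, (vecMulVec (v i) (v i)).trace = 1 := by
      intro i
      rw [Matrix.trace_vecMulVec]
      have := b.orthonormal.1 i
      have h2 : inner ℝ (b i) (b i) = (1 : ℝ) := by
        rw [real_inner_self_eq_norm_sq, this]; norm_num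
      rw [Submodule.coe_inner, hin] at h2
      exact h2
    simp [this]
  · intro x hx
    rw [hP]
    let x' : W' := ⟨L.symm x, by simpa [W'] using hx⟩
    have := b.sum_sq_norm_inner_right x'
    have e : ‖x'‖ ^ 2 = x ⬝ᵥ x := by
      rw [← real_inner_self_eq_norm_sq, Submodule.coe_inner, hin]
      simp [x']
    rw [e] at this
    rw [← this]
    refine Finset.sum_congr rfl fun i _ => ?_
    rw [Submodule.coe_inner, hin]
    simp [x', v]
  · intro x
    rw [hP]
    positivity
  · intro x hx
    rw [hP]
    refine Finset.sum_eq_zero fun i _ => ?_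
    have : v i ∈ W := (b i).2
    rw [hx _ this]
    simp

lemma FU_sum {N d : ℕ} {h : Fin N → Fin d → ℝ} (hf : FU h) (P : Matrix (Fin d) (Fin d) ℝ) :
    ∑ n, (h n ⬝ᵥ P *ᵥ h n) = ((N : ℝ) / d) * P.trace := by
  have := sum_tr (w := fun _ => 1) (v := h) (c := (N : ℝ) / d) (by simpa using hf.1) P
  simpa using this

lemma FU_count {N d : ℕ} (hd : 0 < d) {h : Fin N → Fin d → ℝ} (hf : FU h)
    (W : Submodule ℝ (Fin d → ℝ)) (S : Finset (Fin N)) (hS : ∀ n ∈ S, h n ∈ W) :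
    d * S.card ≤ N * Module.finrank ℝ W := by
  obtain ⟨P, h1, h2, h3, h4⟩ := exists_proj W
  have hs := FU_sum hf P
  have h5 : ∑ n ∈ S, (h n ⬝ᵥ P *ᵥ h n) = S.card := by
    rw [Finset.sum_congr rfl (fun n hn => (h2 _ (hS n hn)).trans (hf.2 n))]
    simp
  have h6 : ∑ n ∈ S, (h n ⬝ᵥ P *ᵥ h n) ≤ ∑ n, (h n ⬝ᵥ P *ᵥ h n) :=
    Finset.sum_le_sum_of_subset_of_nonneg (Finset.subset_univ _) fun _ _ _ => h3 _
  rw [hs, h5, h1] at h6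
  have hd' : (0 : ℝ) < d := by exact_mod_cast hd
  rw [div_mul_eq_mul_div, le_div_iff₀ hd'] at h6
  rw [mul_comm]
  exact_mod_cast h6

lemma FU_count_eq {N d : ℕ} (hd : 0 < d) {h : Fin N → Fin d → ℝ} (hf : FU h)
    (W : Submodule ℝ (Fin d → ℝ)) (S : Finset (Fin N)) (hS : ∀ n ∈ S, h n ∈ W)
    (hS' : ∀ n ∉ S, ∀ y ∈ W, y ⬝ᵥ h n = 0) :
    d * S.card = N * Module.finrank ℝ W := by
  obtain ⟨P, h1, h2, h3, h4⟩ := exists_proj W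
  have hs := FU_sum hf P
  have h5 : ∑ n ∈ S, (h n ⬝ᵥ P *ᵥ h n) = S.card := by
    rw [Finset.sum_congr rfl (fun n hn => (h2 _ (hS n hn)).trans (hf.2 n))]
    simp
  have h6 : ∑ n ∈ S, (h n ⬝ᵥ P *ᵥ h n) = ∑ n, (h n ⬝ᵥ P *ᵥ h n) :=
    Finset.sum_subset (Finset.subset_univ _) fun n _ hn => h4 _ (hS' n hn)
  rw [hs, h5, h1] at h6
  have hd' : (0 : ℝ) < d := by exact_mod_cast hd
  rw [div_mul_eq_mul_div, eq_div_iff hd'.ne'] at h6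
  rw [mul_comm]
  exact_mod_cast h6

open Classical in
/-- stability -/
def Stable {N d : ℕ} (f : Fin N → Fin d → ℝ) : Prop :=
  (∀ n, f n ≠ 0) ∧ ∀ W : Submodule ℝ (Fin d → ℝ), 0 < Module.finrank ℝ W →
    Module.finrank ℝ W < d →
    d * (Finset.univ.filter fun n => f n ∈ W).card < N * Module.finrank ℝ W

lemma conn_of_stable {N d : ℕ} (hd : 0 < d) {f h : Fin N → Fin d → ℝ} (hf : Stable f)
    {g : Matrix (Fin d) (Fin d) ℝ} (hg : g.PosDef) (hh : FU h)
    (hr : ∀ n, ∃ c : ℝ, h n = c • (g *ᵥ f n)) : Conn (fun n => g *ᵥ f n) := by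
  classical
  intro S hS hS'
  by_contra hcon
  push Not at hcon
  have hinj : Function.Injective g.mulVecLin := by
    rw [injective_iff_map_eq_zero]
    intro x hx
    by_contra h0
    exact pd_mulVec_ne hg h0 hx
  set W := Submodule.span ℝ (f '' S) with hW
  have hfr : Module.finrank ℝ (W.map g.mulVecLin) = Module.finrank ℝ W :=
    (LinearEquiv.finrank_eq (Submodule.equivMapOfInjective _ hinj W)).symm
  have hc := FU_count_eq hd hh (W.map g.mulVecLin) (Finset.univ.filter (· ∈ S)) (by
      intro n hn
      obtain ⟨c, hc⟩ := hr n
      rw [hc]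
      refine Submodule.smul_mem _ _ ⟨f n, Submodule.subset_span ⟨n, by simpa using hn, rfl⟩, rfl⟩) (by
      intro n hn y hy
      obtain ⟨c, hc⟩ := hr n
      rw [hc, dotProduct_smul]
      rw [hW, Submodule.map_span, ← Set.image_comp] at hy
      have : y ⬝ᵥ g *ᵥ f n = 0 := by
        induction hy using Submodule.span_induction with
        | mem x hx =>
          obtain ⟨i, hi, rfl⟩ := hx
          exact hcon i hi n (by simpa using hn)
        | zero => simp
        | add x y _ _ hx hy => rw [add_dotProduct, hx, hy, add_zero]
        | smul a x _ hx => rw [smul_dotProduct, hx, smul_zero]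
      rw [this, smul_zero])
  rw [hfr] at hc
  have hpos : 0 < Module.finrank ℝ W := by
    obtain ⟨i, hi⟩ := hS
    rw [Module.finrank_pos_iff]
    exact ⟨⟨⟨f i, Submodule.subset_span ⟨i, hi, rfl⟩⟩, 0, by
      intro h0
      exact hf.1 i (congrArg Subtype.val h0)⟩⟩
  have hlt : Module.finrank ℝ W < d := by
    have hle : (Finset.univ.filter (· ∈ S)).card < N := by
      obtain ⟨j, hj⟩ := hS'
      have : (Finset.univ.filter (· ∈ S)).card < (Finset.univ : Finset (Fin N)).card :=
        Finset.card_lt_card (Finset.filter_ssubset.2 ⟨j, Finset.mem_univ _, hj⟩)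
      simpa using this
    by_contra hge
    have : N * d ≤ N * Module.finrank ℝ W := Nat.mul_le_mul_left _ (not_lt.1 hge)
    rw [← hc, mul_comm] at this
    have := Nat.le_of_mul_le_mul_left this hd
    omega
  have := hf.2 W hpos hlt
  rw [← hc] at this
  have hsub : (Finset.univ.filter (· ∈ S)).card ≤ (Finset.univ.filter fun n => f n ∈ W).card := by
    refine Finset.card_le_card fun n hn => ?_
    simp only [Finset.mem_filter, Finset.mem_univ, true_and] at hn ⊢
    exact Submodule.subset_span ⟨n, hn, rfl⟩
  have := Nat.lt_of_mul_lt_mul_left this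
  omega

lemma sol_of_limit {N d : ℕ} (hd : 0 < d) {f h : Fin N → Fin d → ℝ} (hf : Stable f)
    {g : Matrix (Fin d) (Fin d) ℝ} (hs : gᵀ = g) (hpsd : ∀ x, 0 ≤ x ⬝ᵥ g *ᵥ x)
    (htr : g.trace = d) (hh : FU h)
    (hr : ∀ n, g *ᵥ f n = Real.sqrt (rr g f n) • h n) : Sol f g := by
  classical
  have hPSD : g.PosSemidef := by
    refine Matrix.PosSemidef.of_dotProduct_mulVec_nonneg ?_ ?_
    · simpa [Matrix.IsHermitian] using hs
    · intro x
      simpa using hpsd x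
  have hrank := LinearMap.finrank_range_add_finrank_ker g.mulVecLin
  simp only [Module.finrank_fin_fun] at hrank
  have hrpos : 0 < Module.finrank ℝ (LinearMap.range g.mulVecLin) := by
    rw [Nat.pos_iff_ne_zero]
    intro h0
    have hz := Submodule.finrank_eq_zero.1 h0
    have : g = 0 := by
      have h1 : g.mulVecLin = 0 := LinearMap.range_eq_bot.1 hz
      ext i j
      have := congrFun (congrArg (fun l => l (Pi.single j 1)) h1) i
      simpa using this
    rw [this] at htr
    rw [Matrix.trace_zero] at htr
    have : (0:ℝ) < d := by exact_mod_cast hd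
    linarith
  have hcount := FU_count hd hh (LinearMap.range g.mulVecLin)
    (Finset.univ.filter fun n => ¬ f n ∈ LinearMap.ker g.mulVecLin) (by
      intro n hn
      simp only [Finset.mem_filter, Finset.mem_univ, true_and, LinearMap.mem_ker,
        Matrix.mulVecLin_apply] at hn
      have hs0 : Real.sqrt (rr g f n) ≠ 0 := by
        intro h0
        apply hn
        rw [hr, h0, zero_smul]
      refine ⟨(Real.sqrt (rr g f n))⁻¹ • f n, ?_⟩
      rw [map_smul, Matrix.mulVecLin_apply, hr n, smul_smul, inv_mul_cancel₀ hs0, one_smul])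
  have hsum := Finset.card_filter_add_card_filter_not (s := (Finset.univ : Finset (Fin N)))
    (fun n => f n ∈ LinearMap.ker g.mulVecLin)
  simp only [Finset.card_univ, Fintype.card_fin] at hsum
  have hk : Module.finrank ℝ (LinearMap.ker g.mulVecLin) = 0 := by
    by_contra hk
    have := hf.2 _ (Nat.pos_of_ne_zero hk) (by omega)
    have e1 : N * d = N * Module.finrank ℝ (LinearMap.range g.mulVecLin) +
        N * Module.finrank ℝ (LinearMap.ker g.mulVecLin) := by
      rw [← mul_add, hrank]
    have e2 := congrArg (d * ·) hsum
    simp only [mul_add] at e2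
    rw [mul_comm d N] at e2
    omega
  have hker : ∀ x, g *ᵥ x = 0 → x = 0 := by
    intro x hx
    have hb := Submodule.finrank_eq_zero.1 hk
    have : x ∈ LinearMap.ker g.mulVecLin := hx
    rw [hb] at this
    simpa using this
  have hPD : g.PosDef := by
    refine pd_of hs fun x hx => lt_of_le_of_ne (hpsd x) fun h0 => hx (hker x ?_)
    refine (hPSD.dotProduct_mulVec_zero_iff x).1 ?_
    simpa using h0.symm
  have hrp : ∀ n, 0 < rr g f n := fun n => dot_pos (pd_mulVec_ne hPD (hf.1 n))
  have hh' : ∀ n, h n = (Real.sqrt (rr g f n))⁻¹ • (g *ᵥ f n) := by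
    intro n
    conv_rhs => rw [hr n]
    rw [smul_smul, inv_mul_cancel₀ (Real.sqrt_pos.2 (hrp n)).ne', one_smul]
  refine ⟨hPD, htr, hf.1, ?_, conn_of_stable hd hf hPD hh fun n => ⟨_, hh' n⟩⟩
  rw [← hh.1, TT]
  refine Finset.sum_congr rfl fun n _ => ?_
  rw [hh' n, Matrix.smul_vecMulVec, Matrix.vecMulVec_smul, smul_smul, ← mul_inv,
      Real.mul_self_sqrt (hrp n).le]

set_option maxHeartbeats 1000000 in
lemma closure_stable {N d : ℕ} (hd : 0 < d) {f : Fin N → Fin d → ℝ} (hf : Stable f)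
    (hcl : f ∈ closure (UU N d)) : f ∈ UU N d := by
  obtain ⟨x, hx, hlim⟩ := mem_closure_iff_seq_limit.1 hcl
  have hb : ∀ k, (gam (x k), Phi (x k)) ∈
      (Metric.closedBall (0 : (Fin d → Fin d → ℝ) × (Fin N → Fin d → ℝ)) (d + 1)) := by
    intro k
    have hS := gam_spec (hx k)
    have hF := Phi_FU (hx k)
    have hd0 : (0 : ℝ) ≤ d := by positivity
    rw [mem_closedBall_zero_iff, Prod.norm_def, max_le_iff]
    constructor
    · refine (pi_norm_le_iff_of_nonneg (by positivity)).2 fun a =>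
        (pi_norm_le_iff_of_nonneg (by positivity)).2 fun b => ?_
      have hp := hS.pos.posSemidef
      have hdiag : ∀ a, 0 ≤ gam (x k) a a := fun a => hp.diag_nonneg
      have hle : ∀ a, gam (x k) a a ≤ d := by
        intro a
        have := hS.tr
        rw [← this, Matrix.trace]
        exact Finset.single_le_sum (f := fun i => (Matrix.of (gam (x k))).diag i)
          (fun i _ => hdiag i) (Finset.mem_univ a)
      have hsy : gam (x k) b a = gam (x k) a b := by
        have := congrFun (congrFun (pd_symm hS.pos) a) b
        simpa using this
      have hq : ∀ s : ℝ, 0 ≤ gam (x k) a a + s * gam (x k) a b + s * gam (x k) b a +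
          s * s * gam (x k) b b := by
        intro s
        have := hp.dotProduct_mulVec_nonneg (Pi.single a 1 + s • Pi.single b 1)
        simp only [star_trivial, Matrix.mulVec_add, Matrix.mulVec_smul, add_dotProduct,
          dotProduct_add, smul_dotProduct, dotProduct_smul, single_dotProduct, smul_eq_mul,
          Matrix.mulVec_single_one, Matrix.col_apply, Matrix.of_apply, one_mul] at this
        linarith
      have q1 := hq 1
      have q2 := hq (-1)
      have := hle a
      have := hle b
      rw [Real.norm_eq_abs, abs_le]
      constructor <;> linarith
    · refine (pi_norm_le_iff_of_nonneg (by positivity)).2 fun n =>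
        (pi_norm_le_iff_of_nonneg (by positivity)).2 fun a => ?_
      have h1 := hF.2 n
      have h2 : Phi (x k) n a * Phi (x k) n a ≤ Phi (x k) n ⬝ᵥ Phi (x k) n :=
        Finset.single_le_sum (f := fun i => Phi (x k) n i * Phi (x k) n i)
          (fun i _ => mul_self_nonneg _) (Finset.mem_univ a)
      rw [h1] at h2
      have : |Phi (x k) n a| ≤ 1 := by
        rw [abs_le]
        constructor <;> nlinarith
      rw [Real.norm_eq_abs]
      linarith
  obtain ⟨⟨g, h⟩, -, φ, hφ, hgh⟩ := (isCompact_closedBall _ _).tendsto_subseq hb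
  have hxφ : Filter.Tendsto (fun k => x (φ k)) Filter.atTop (𝓝 f) := hlim.comp hφ.tendsto_atTop
  have ht : Filter.Tendsto (fun k => (x (φ k), (gam (x (φ k)), Phi (x (φ k))))) Filter.atTop
      (𝓝 (f, (g, h))) := hxφ.prodMk_nhds hgh
  have lim : ∀ (A B : (Fin N → Fin d → ℝ) × ((Fin d → Fin d → ℝ) × (Fin N → Fin d → ℝ)) → ℝ),
      Continuous A → Continuous B →
      (∀ k, A (x (φ k), (gam (x (φ k)), Phi (x (φ k)))) =
        B (x (φ k), (gam (x (φ k)), Phi (x (φ k))))) → A (f, (g, h)) = B (f, (g, h)) := by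
    intro A B hA hB hAB
    refine tendsto_nhds_unique ((hA.tendsto _).comp ht) ?_
    refine ((hB.tendsto _).comp ht).congr fun k => (hAB k).symm
  refine ⟨g, sol_of_limit hd hf (h := h) ?_ ?_ ?_ ⟨?_, ?_⟩ ?_⟩
  · ext a b
    refine lim (fun u => u.2.1 b a) (fun u => u.2.1 a b) (by fun_prop) (by fun_prop) fun k => ?_
    exact congrFun (congrFun (pd_symm (gam_spec (hx (φ k))).pos) a) b
  · intro y
    have hc : Continuous (fun u : (Fin N → Fin d → ℝ) × ((Fin d → Fin d → ℝ) ×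
        (Fin N → Fin d → ℝ)) => y ⬝ᵥ (Matrix.of u.2.1) *ᵥ y) := by
      simp only [Matrix.mulVec, dotProduct, Matrix.of_apply]
      fun_prop
    refine ge_of_tendsto' ((hc.tendsto _).comp ht) fun k => ?_
    simpa using (gam_spec (hx (φ k))).pos.posSemidef.dotProduct_mulVec_nonneg y
  · refine lim (fun u => (Matrix.of u.2.1).trace) (fun u => d) ?_ (by fun_prop) fun k => ?_
    · simp only [Matrix.trace, Matrix.diag, Matrix.of_apply]
      fun_prop
    · exact (gam_spec (hx (φ k))).tr
  · ext a b
    refine lim (fun u => (∑ n, vecMulVec (u.2.2 n) (u.2.2 n)) a b)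
      (fun u => (((N : ℝ) / d) • (1 : Matrix (Fin d) (Fin d) ℝ)) a b) ?_ (by fun_prop) fun k => ?_
    · simp only [Matrix.sum_apply, Matrix.vecMulVec_apply]
      fun_prop
    · exact congrFun (congrFun (Phi_FU (hx (φ k))).1 a) b
  · intro n
    refine lim (fun u => u.2.2 n ⬝ᵥ u.2.2 n) (fun u => 1) ?_ (by fun_prop) fun k => ?_
    · simp only [dotProduct]
      fun_prop
    · exact (Phi_FU (hx (φ k))).2 n
  · intro n
    ext a
    refine lim (fun u => (Matrix.of u.2.1 *ᵥ u.1 n) a)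
      (fun u => (Real.sqrt (rr (Matrix.of u.2.1) u.1 n) • u.2.2 n) a) ?_ ?_ fun k => ?_
    · simp only [Matrix.mulVec, dotProduct, Matrix.of_apply]
      fun_prop
    · simp only [rr, Pi.smul_apply, smul_eq_mul, Matrix.mulVec, dotProduct, Matrix.of_apply]
      fun_prop
    · have hp := (gam_spec (hx (φ k))).rr_pos n
      have : Phi (x (φ k)) n = (Real.sqrt (rr (Matrix.of (gam (x (φ k)))) (x (φ k)) n))⁻¹ •
        (Matrix.of (gam (x (φ k))) *ᵥ x (φ k) n) := rfl
      change _ = (Real.sqrt (rr (Matrix.of (gam (x (φ k)))) (x (φ k)) n) • Phi (x (φ k)) n) a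
      rw [this, smul_smul, mul_inv_cancel₀ (Real.sqrt_pos.2 hp).ne', one_smul]

lemma propagate {E : Type*} [NormedAddCommGroup E] [NormedSpace ℝ E] {Q : E → ℝ} {U : Set E}
    (hU : IsOpen U) (hQ : ∀ x ∈ U, AnalyticAt ℝ Q x) {f f' : E}
    (hcl : ∀ x ∈ segment ℝ f f', x ∈ closure U → x ∈ U)
    (hf : f ∈ U) (h : ∀ᶠ x in 𝓝 f, Q x = 0) : f' ∈ U ∧ ∀ᶠ x in 𝓝 f', Q x = 0 := by
  have hpre : IsPreconnected (segment ℝ f f') := (convex_segment f f').isPreconnected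
  have hsub : segment ℝ f f' ⊆ U :=
    hpre.subset_of_closure_inter_subset hU ⟨f, left_mem_segment ℝ f f', hf⟩
      fun x hx => hcl x hx.2 hx.1
  have hC : segment ℝ f f' ⊆ connectedComponentIn U f :=
    hpre.subset_connectedComponentIn (left_mem_segment ℝ f f') hsub
  refine ⟨hsub (right_mem_segment ℝ f f'), ?_⟩
  have hz := AnalyticOnNhd.eqOn_zero_of_preconnected_of_eventuallyEq_zero
    (f := Q) (U := connectedComponentIn U f)
    (fun x hx => hQ x (connectedComponentIn_subset _ _ hx))
    isPreconnected_connectedComponentIn (hC (left_mem_segment ℝ f f')) h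
  have hm : connectedComponentIn U f ∈ 𝓝 f' :=
    hU.connectedComponentIn.mem_nhds (hC (right_mem_segment ℝ f f'))
  filter_upwards [hm] with x hx
  exact hz hx

lemma segment_step {N d : ℕ} (i0 : Fin N) (hd : 0 < d) (q : MvPolynomial (Fin d × Fin N) ℝ)
    {f f' : Fin N → Fin d → ℝ} (hs : ∀ x ∈ segment ℝ f f', Stable x)
    (h : f ∈ UU N d ∧ ∀ᶠ x in 𝓝 f, MvPolynomial.eval (fun v => Phi x v.2 v.1) q = 0) :
    f' ∈ UU N d ∧ ∀ᶠ x in 𝓝 f', MvPolynomial.eval (fun v => Phi x v.2 v.1) q = 0 :=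
  propagate (UU_open i0 hd) (fun _ hx => eval_analyticAt i0 hd q hx)
    (fun x hx hc => closure_stable hd (hs x hx) hc) h.1 h.2

lemma dense_avoid {d : ℕ} {κ : Type*} [Finite κ] (W : κ → Submodule ℝ (Fin d → ℝ))
    (hW : ∀ k, W k ≠ ⊤) : Dense {x : Fin d → ℝ | ∀ k, x ∉ W k} := by
  have : {x : Fin d → ℝ | ∀ k, x ∉ W k} = ⋂ k, ((W k : Set (Fin d → ℝ)))ᶜ := by
    ext x
    simp
  rw [this]
  refine dense_iInter_of_isOpen (fun k => (Submodule.closed_of_finiteDimensional _).isOpen_compl)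
    fun k => ?_
  rw [← interior_eq_empty_iff_dense_compl]
  by_contra h
  exact hW k (Submodule.eq_top_of_nonempty_interior' _ (Set.nonempty_iff_ne_empty.2 h))

lemma span_ne_top {d : ℕ} (s : Finset (Fin d → ℝ)) (hs : s.card < d) :
    Submodule.span ℝ (s : Set (Fin d → ℝ)) ≠ ⊤ := by
  intro h
  have h1 := finrank_span_finset_le_card (R := ℝ) s
  rw [Set.finrank, h, finrank_top, Module.finrank_fin_fun] at h1
  omega

lemma finrank_span_image {d : ℕ} {ι : Type*} {f : ι → Fin d → ℝ} {s : Finset ι}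
    (h : LinearIndepOn ℝ f (s : Set ι)) :
    Module.finrank ℝ (Submodule.span ℝ (f '' (s : Set ι))) = s.card := by
  have := finrank_span_eq_card (R := ℝ) (b := fun i : s => f i) h
  rw [Fintype.card_coe] at this
  rw [← this, Set.image_eq_range]
  rfl

lemma stable_of {N d : ℕ} (hd : 3 ≤ d) (hN : d + 2 ≤ N) {f : Fin N → Fin d → ℝ} (n0 : Fin N)
    (hg : ∀ s : Finset (Fin N), n0 ∉ s → s.card ≤ d → LinearIndepOn ℝ f (s : Set (Fin N)))
    (hn : ∀ s : Finset (Fin N), n0 ∉ s → s.card ≤ d - 2 →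
      f n0 ∉ Submodule.span ℝ (f '' (s : Set (Fin N)))) : Stable f := by
  classical
  refine ⟨?_, ?_⟩
  · intro n h0
    by_cases h : n = n0
    · subst h
      exact hn ∅ (by simp) (by simp) (by rw [h0]; exact Submodule.zero_mem _)
    · have := hg {n} (by simpa using fun h' => h h'.symm) (by simp; omega)
      exact (LinearIndepOn.ne_zero this (i := n) (by simp)) h0
  · intro W hW0 hWd
    set T := Finset.univ.filter fun n => f n ∈ W with hT
    have hTW : ∀ s : Finset (Fin N), s ⊆ T → Submodule.span ℝ (f '' (s : Set (Fin N))) ≤ W := by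
      intro s hs
      rw [Submodule.span_le]
      rintro _ ⟨i, hi, rfl⟩
      have := hs hi
      simpa [hT] using this
    have h1 : ∀ s : Finset (Fin N), s ⊆ T → n0 ∉ s → s.card ≤ d → s.card ≤ Module.finrank ℝ W := by
      intro s hs h0 hc
      rw [← finrank_span_image (hg s h0 hc)]
      exact Submodule.finrank_mono (hTW s hs)
    have h2 : (T.erase n0).card ≤ Module.finrank ℝ W := by
      by_contra hlt
      obtain ⟨s, hs, hc⟩ := Finset.exists_subset_card_eq (Nat.succ_le_of_lt (not_le.1 hlt))
      have := h1 s (hs.trans (Finset.erase_subset _ _)) (fun h => by simpa using hs h) (by omega)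
      omega
    have hle : T.card ≤ (T.erase n0).card + 1 := by
      have := Finset.pred_card_le_card_erase (s := T) (a := n0)
      omega
    by_cases hk : Module.finrank ℝ W ≤ d - 2
    · have h3 : T.card ≤ Module.finrank ℝ W := by
        by_cases hmem : n0 ∈ T
        · by_contra hlt
          have e : (T.erase n0).card = Module.finrank ℝ W := by omega
          have hspan : Submodule.span ℝ (f '' ((T.erase n0 : Finset (Fin N)) : Set (Fin N))) = W := by
            refine Submodule.eq_of_le_of_finrank_le (hTW _ (Finset.erase_subset _ _)) ?_
            rw [finrank_span_image (hg _ (by simp) (by omega)), e]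
          refine hn (T.erase n0) (by simp) (by omega) ?_
          rw [hspan]
          simpa [hT] using hmem
        · rwa [Finset.erase_eq_of_notMem hmem] at h2
      calc d * T.card ≤ d * Module.finrank ℝ W := Nat.mul_le_mul_left _ h3
        _ < N * Module.finrank ℝ W := Nat.mul_lt_mul_of_pos_right (by omega) hW0
    · have h3 : T.card ≤ d := by omega
      have h4 : Module.finrank ℝ W = d - 1 := by omega
      obtain ⟨e, rfl⟩ : ∃ e, d = e + 1 := ⟨d - 1, by omega⟩
      rw [h4]
      simp only [Nat.add_sub_cancel]
      nlinarith

lemma stable_seg {N d : ℕ} (hd : 3 ≤ d) (hN : d + 2 ≤ N) {f : Fin N → Fin d → ℝ} (n0 : Fin N)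
    (hg : ∀ s : Finset (Fin N), n0 ∉ s → s.card ≤ d → LinearIndepOn ℝ f (s : Set (Fin N)))
    (x z : Fin d → ℝ)
    (hx : ∀ s : Finset (Fin N), n0 ∉ s → s.card ≤ d - 2 →
      x ∉ Submodule.span ℝ (f '' (s : Set (Fin N))))
    (hz : ∀ s : Finset (Fin N), n0 ∉ s → s.card ≤ d - 2 →
      z ∉ Submodule.span ℝ (insert x (f '' (s : Set (Fin N))))) :
    ∀ y ∈ segment ℝ (Function.update f n0 x) (Function.update f n0 z), Stable y := by
  rintro y ⟨a, b, ha, hb, hab, rfl⟩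
  have e : a • Function.update f n0 x + b • Function.update f n0 z =
      Function.update f n0 (a • x + b • z) := by
    funext n
    by_cases h : n = n0
    · subst h; simp
    · simp [h, ← add_smul, hab]
  rw [e]
  have heq : ∀ (w : Fin d → ℝ) (s : Finset (Fin N)), n0 ∉ s →
      Set.EqOn f (Function.update f n0 w) (s : Set (Fin N)) := by
    intro w s hs i hi
    rw [Function.update_of_ne]
    rintro rfl
    exact hs hi
  refine stable_of hd hN n0 ?_ ?_
  · intro s hs hc
    exact (hg s hs hc).congr (heq _ s hs)
  · intro s hs hc hmem
    rw [← Set.image_congr (heq _ s hs), Function.update_self] at hmem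
    by_cases hb0 : b = 0
    · subst hb0
      rw [add_zero] at hab
      subst hab
      simp only [one_smul, zero_smul, add_zero] at hmem
      exact hx s hs hc hmem
    · refine hz s hs hc ?_
      have h1 : a • x + b • z ∈ Submodule.span ℝ (insert x (f '' (s : Set (Fin N)))) :=
        Submodule.span_mono (Set.subset_insert _ _) hmem
      have h2 : x ∈ Submodule.span ℝ (insert x (f '' (s : Set (Fin N)))) :=
        Submodule.subset_span (Set.mem_insert _ _)
      have h3 : b • z ∈ Submodule.span ℝ (insert x (f '' (s : Set (Fin N)))) := by
        have := Submodule.sub_mem _ h1 (Submodule.smul_mem _ a h2)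
        simpa using this
      exact (Submodule.smul_mem_iff _ hb0).1 h3

lemma move {N d : ℕ} (hd : 3 ≤ d) (hN : d + 2 ≤ N) (P : (Fin N → Fin d → ℝ) → Prop)
    (hP : ∀ f f', (∀ x ∈ segment ℝ f f', Stable x) → P f → P f')
    {f : Fin N → Fin d → ℝ} (n0 : Fin N)
    (hg : ∀ s : Finset (Fin N), n0 ∉ s → s.card ≤ d → LinearIndepOn ℝ f (s : Set (Fin N)))
    (x y : Fin d → ℝ)
    (hx : ∀ s : Finset (Fin N), n0 ∉ s → s.card ≤ d - 2 →
      x ∉ Submodule.span ℝ (f '' (s : Set (Fin N))))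
    (hy : ∀ s : Finset (Fin N), n0 ∉ s → s.card ≤ d - 2 →
      y ∉ Submodule.span ℝ (f '' (s : Set (Fin N))))
    (h : P (Function.update f n0 x)) : P (Function.update f n0 y) := by
  classical
  have hcard : ∀ (w : Fin d → ℝ) (s : Finset (Fin N)), s.card ≤ d - 2 →
      Submodule.span ℝ (insert w (f '' (s : Set (Fin N)))) ≠ ⊤ := by
    intro w s hs
    have e : (insert w (f '' (s : Set (Fin N)))) = ((insert w (s.image f) : Finset (Fin d → ℝ)) :
      Set (Fin d → ℝ)) := by simp
    rw [e]
    refine span_ne_top _ ?_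
    have h1 := Finset.card_insert_le w (s.image f)
    have h2 := Finset.card_image_le (s := s) (f := f)
    omega
  obtain ⟨z, hz⟩ := (dense_avoid (κ := {s : Finset (Fin N) // s.card ≤ d - 2} × Bool)
    (fun k => Submodule.span ℝ (insert (if k.2 then x else y) (f '' (k.1.1 : Set (Fin N)))))
    (fun k => hcard _ _ k.1.2)).nonempty
  have hzx : ∀ s : Finset (Fin N), n0 ∉ s → s.card ≤ d - 2 →
      z ∉ Submodule.span ℝ (insert x (f '' (s : Set (Fin N)))) := fun s _ hc => by
    simpa using hz (⟨s, hc⟩, true)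
  have hzy : ∀ s : Finset (Fin N), n0 ∉ s → s.card ≤ d - 2 →
      z ∉ Submodule.span ℝ (insert y (f '' (s : Set (Fin N)))) := fun s _ hc => by
    simpa using hz (⟨s, hc⟩, false)
  refine hP _ _ ?_ (hP _ _ (stable_seg hd hN n0 hg x z hx hzx) h)
  rw [segment_symm]
  exact stable_seg hd hN n0 hg y z hy hzy

/-- general position -/
def Gen {d : ℕ} {ι : Type*} (c : ι → Fin d → ℝ) : Prop :=
  ∀ s : Finset ι, s.card ≤ d → LinearIndepOn ℝ c (s : Set ι)

lemma Gen.notMem {d : ℕ} {ι : Type*} {c : ι → Fin d → ℝ} (hc : Gen c) (i : ι) (s : Finset ι)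
    (hi : i ∉ s) (hs : s.card < d) : c i ∉ Submodule.span ℝ (c '' (s : Set ι)) := by
  classical
  have := hc (insert i s) (by rw [Finset.card_insert_of_notMem hi]; omega)
  rw [Finset.coe_insert, linearIndepOn_insert (by simpa using hi)] at this
  exact this.2

lemma chain {N d : ℕ} (hd : 3 ≤ d) (hN : d + 2 ≤ N) (P : (Fin N → Fin d → ℝ) → Prop)
    (hP : ∀ f f', (∀ x ∈ segment ℝ f f', Stable x) → P f → P f')
    (c : Fin N ⊕ Fin N → Fin d → ℝ) (hc : Gen c) (h : P (fun n => c (Sum.inl n))) :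
    P (fun n => c (Sum.inr n)) := by
  classical
  let σ : ℕ → Fin N → Fin N ⊕ Fin N := fun j n => if n.val < j then Sum.inr n else Sum.inl n
  have hσ : ∀ j, Function.Injective (σ j) := by
    intro j m n hmn
    simp only [σ] at hmn
    split_ifs at hmn <;> simpa using hmn
  have key : ∀ j, j ≤ N → P (fun n => c (σ j n)) := by
    intro j
    induction j with
    | zero => intro _; simpa [σ] using h
    | succ j ih =>
      intro hj
      have h0 := ih (by omega)
      let n0 : Fin N := ⟨j, by omega⟩
      let f : Fin N → Fin d → ℝ := fun n => c (σ j n)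
      have himg : ∀ s : Finset (Fin N), f '' (s : Set (Fin N)) =
          c '' ((s.image (σ j) : Finset (Fin N ⊕ Fin N)) : Set (Fin N ⊕ Fin N)) := by
        intro s
        rw [Finset.coe_image, ← Set.image_comp]
        rfl
      have hcard : ∀ s : Finset (Fin N), (s.image (σ j)).card = s.card :=
        fun s => Finset.card_image_of_injective _ (hσ j)
      have e1 : (fun n => c (σ j n)) = Function.update f n0 (f n0) := by simp [f]
      have e2 : (fun n => c (σ (j + 1) n)) = Function.update f n0 (c (Sum.inr n0)) := by
        funext n
        by_cases hn : n = n0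
        · subst hn
          simp [σ, n0]
        · rw [Function.update_of_ne hn]
          have : n.val ≠ j := fun h' => hn (Fin.ext h')
          have h'' : n.val < j + 1 ↔ n.val < j := by omega
          simp only [f, σ, h'']
      rw [e1] at h0
      rw [e2]
      refine move hd hN P hP n0 ?_ _ _ ?_ ?_ h0
      · intro s _ hs
        have := hc (s.image (σ j)) (by rw [hcard]; exact hs)
        rw [Finset.coe_image] at this
        exact this.comp_of_image (hσ j).injOn
      · intro s hn hs
        rw [himg]
        refine hc.notMem (σ j n0) _ ?_ (by rw [hcard]; omega)
        rw [Finset.mem_image]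
        rintro ⟨m, hm, hm'⟩
        rw [hσ j hm'] at hm
        exact hn hm
      · intro s hn hs
        rw [himg]
        refine hc.notMem (Sum.inr n0) _ ?_ (by rw [hcard]; omega)
        rw [Finset.mem_image]
        rintro ⟨m, hm, hm'⟩
        simp only [σ] at hm'
        split_ifs at hm' with hlt
        have : m = n0 := by simpa using hm'
        rw [this] at hm
        exact hn hm
  have := key N le_rfl
  simpa [σ] using this

lemma exists_gen {d : ℕ} {ι : Type*} [Fintype ι] (c : ι → Fin d → ℝ)
    {ε : ℝ} (hε : 0 < ε) : ∃ cc : ι → Fin d → ℝ, (∀ i, dist (cc i) (c i) < ε) ∧ Gen cc := by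
  classical
  have key : ∀ T : Finset ι, ∃ cc : ι → Fin d → ℝ, (∀ i, dist (cc i) (c i) < ε) ∧
      ∀ s : Finset ι, s ⊆ T → s.card ≤ d → LinearIndepOn ℝ cc (s : Set ι) := by
    intro T
    induction T using Finset.induction_on with
    | empty =>
      refine ⟨c, fun i => by simpa using hε, fun s hs _ => ?_⟩
      rw [Finset.subset_empty.1 hs]
      simp
    | insert i T hi ih =>
      obtain ⟨cc, h1, h2⟩ := ih
      have hdense := dense_avoid (κ := {s : Finset ι // s.card < d})
        (fun k => Submodule.span ℝ (cc '' (k.1 : Set ι))) (by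
          intro k
          have e : cc '' (k.1 : Set ι) = ((k.1.image cc : Finset (Fin d → ℝ)) :
            Set (Fin d → ℝ)) := by simp
          rw [e]
          exact span_ne_top _ (lt_of_le_of_lt Finset.card_image_le k.2))
      obtain ⟨v, hv, hvd⟩ := hdense.exists_dist_lt (c i) hε
      have heq : ∀ s : Finset ι, i ∉ s → Set.EqOn cc (Function.update cc i v) (s : Set ι) := by
        intro s hs j hj
        rw [Function.update_of_ne]
        rintro rfl
        exact hs hj
      refine ⟨Function.update cc i v, ?_, ?_⟩
      · intro j
        by_cases hj : j = i
        · subst hj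
          rw [Function.update_self, dist_comm]
          exact hvd
        · rw [Function.update_of_ne hj]
          exact h1 j
      · intro s hs hc
        by_cases his : i ∈ s
        · have hsub : s.erase i ⊆ T := by
            intro j hj
            have hj' := Finset.mem_erase.1 hj
            exact (Finset.mem_insert.1 (hs hj'.2)).resolve_left hj'.1
          have hcard := Finset.card_erase_lt_of_mem his
          rw [← Finset.insert_erase his, Finset.coe_insert, linearIndepOn_insert (by simp),
            ← Set.image_congr (heq (s.erase i) (by simp)), Function.update_self]
          exact ⟨(h2 _ hsub (by omega)).congr (heq _ (by simp)), hv ⟨s.erase i, by omega⟩⟩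
        · refine (h2 s ?_ hc).congr (heq s his)
          intro j hj
          refine (Finset.mem_insert.1 (hs hj)).resolve_left ?_
          rintro rfl
          exact his hj
  obtain ⟨cc, h1, h2⟩ := key Finset.univ
  exact ⟨cc, h1, fun s hs => h2 s (Finset.subset_univ _) hs⟩

/-- rotating two vectors of a family -/
def rot {N d : ℕ} (i j : Fin N) (h : Fin N → Fin d → ℝ) (θ : ℝ) : Fin N → Fin d → ℝ := fun n =>
  if n = i then Real.cos θ • h i + Real.sin θ • h j
  else if n = j then Real.cos θ • h j - Real.sin θ • h i else h n

lemma rot_cont {N d : ℕ} (i j : Fin N) (h : Fin N → Fin d → ℝ) (n : Fin N) (a : Fin d) :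
    Continuous fun θ => rot i j h θ n a := by
  unfold rot
  split_ifs
  · simp only [Pi.add_apply, Pi.smul_apply, smul_eq_mul]
    fun_prop
  · simp only [Pi.sub_apply, Pi.smul_apply, smul_eq_mul]
    fun_prop
  · fun_prop

lemma rot_zero {N d : ℕ} (i j : Fin N) (h : Fin N → Fin d → ℝ) : rot i j h 0 = h := by
  funext n
  unfold rot
  split_ifs with h1 h2
  · simp [h1]
  · simp [h2]
  · rfl

lemma rot_FU {N d : ℕ} {i j : Fin N} (hij : i ≠ j) {h : Fin N → Fin d → ℝ} (hf : FU h)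
    (h0 : h i ⬝ᵥ h j = 0) (θ : ℝ) : FU (rot i j h θ) := by
  have hi : rot i j h θ i = Real.cos θ • h i + Real.sin θ • h j := by simp [rot]
  have hj : rot i j h θ j = Real.cos θ • h j - Real.sin θ • h i := by simp [rot, hij.symm]
  have hn : ∀ n, n ≠ i → n ≠ j → rot i j h θ n = h n := by
    intro n h1 h2
    simp [rot, h1, h2]
  have hsc := Real.sin_sq_add_cos_sq θ
  have h0' : h j ⬝ᵥ h i = 0 := by rw [dotProduct_comm]; exact h0
  constructor
  · rw [← hf.1, ← sub_eq_zero, ← Finset.sum_sub_distrib,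
      Fintype.sum_eq_add i j hij (by
        rintro n ⟨h1, h2⟩
        rw [hn n h1 h2, sub_self]), hi, hj]
    ext a b
    simp only [Matrix.add_apply, Matrix.sub_apply, Matrix.vecMulVec_apply, Pi.add_apply,
      Pi.sub_apply, Pi.smul_apply, smul_eq_mul, Matrix.zero_apply]
    linear_combination (h i a * h i b + h j a * h j b) * hsc
  · intro n
    by_cases h1 : n = i
    · rw [h1, hi]
      simp only [add_dotProduct, dotProduct_add, smul_dotProduct, dotProduct_smul, hf.2, h0, h0',
        smul_eq_mul]
      linear_combination hsc
    · by_cases h2 : n = j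
      · rw [h2, hj]
        simp only [sub_dotProduct, dotProduct_sub, smul_dotProduct, dotProduct_smul, hf.2, h0, h0',
          smul_eq_mul]
        linear_combination hsc
      · rw [hn n h1 h2]
        exact hf.2 n

open Classical in
/-- number of non-orthogonal pairs -/
def prs {N d : ℕ} (h : Fin N → Fin d → ℝ) : Finset (Fin N × Fin N) :=
  Finset.univ.filter fun x => h x.1 ⬝ᵥ h x.2 ≠ 0

lemma exists_partner {N d : ℕ} (hd : 0 < d) (hN : d < N) {h : Fin N → Fin d → ℝ} (hf : FU h)
    (j : Fin N) : ∃ k, k ≠ j ∧ h j ⬝ᵥ h k ≠ 0 := by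
  by_contra hcon
  push Not at hcon
  have h1 := FU_sum hf (vecMulVec (h j) (h j))
  rw [Matrix.trace_vecMulVec, hf.2 j, Fintype.sum_eq_single j (by
    intro k hk
    rw [Matrix.vecMulVec_mulVec, hcon k hk]
    simp), Matrix.vecMulVec_mulVec, hf.2 j] at h1
  have hd' : (0 : ℝ) < d := by exact_mod_cast hd
  have hN' : (d : ℝ) < N := by exact_mod_cast hN
  simp [hf.2 j] at h1
  have := (one_lt_div hd').2 hN'
  linarith

lemma improve {N d : ℕ} (hd : 0 < d) (hN : d < N) (p : MvPolynomial (Fin d × Fin N) ℝ)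
    {h : Fin N → Fin d → ℝ} (hf : FU h) (hp : MvPolynomial.eval (fun v => h v.2 v.1) p ≠ 0)
    (hc : ¬ Conn h) : ∃ h' : Fin N → Fin d → ℝ, FU h' ∧
      MvPolynomial.eval (fun v => h' v.2 v.1) p ≠ 0 ∧ prs h ⊂ prs h' := by
  unfold Conn at hc
  push Not at hc
  obtain ⟨S, ⟨i, hi⟩, ⟨j, hj⟩, hS⟩ := hc
  obtain ⟨k, hkj, hk⟩ := exists_partner hd hN hf j
  have hkS : k ∉ S := by
    intro hkS
    apply hk
    rw [dotProduct_comm]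
    exact hS k hkS j hj
  have hij : i ≠ j := by
    rintro rfl
    exact hj hi
  have hki : k ≠ i := by
    rintro rfl
    exact hkS hi
  have e1 : ∀ᶠ θ in 𝓝 (0 : ℝ), MvPolynomial.eval (fun v => rot i j h θ v.2 v.1) p ≠ 0 := by
    have hcont : Continuous fun θ => MvPolynomial.eval (fun v : Fin d × Fin N =>
        rot i j h θ v.2 v.1) p :=
      (MvPolynomial.continuous_eval p).comp (continuous_pi fun v => rot_cont i j h v.2 v.1)
    refine hcont.continuousAt.eventually_ne ?_
    rw [rot_zero]
    exact hp
  have e2 : ∀ᶠ θ in 𝓝 (0 : ℝ), ∀ x : Fin N × Fin N, h x.1 ⬝ᵥ h x.2 ≠ 0 →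
      rot i j h θ x.1 ⬝ᵥ rot i j h θ x.2 ≠ 0 := by
    rw [Filter.eventually_all]
    intro x
    by_cases hx : h x.1 ⬝ᵥ h x.2 = 0
    · exact Filter.Eventually.of_forall fun _ h' => absurd hx h'
    · have hcont : Continuous fun θ => rot i j h θ x.1 ⬝ᵥ rot i j h θ x.2 :=
        continuous_finsetSum _ fun a _ => (rot_cont i j h _ a).mul (rot_cont i j h _ a)
      have : ∀ᶠ θ in 𝓝 (0 : ℝ), rot i j h θ x.1 ⬝ᵥ rot i j h θ x.2 ≠ 0 := by
        refine hcont.continuousAt.eventually_ne ?_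
        rw [rot_zero]
        exact hx
      filter_upwards [this] with θ hθ _ using hθ
  have e3 : ∀ᶠ θ in 𝓝[>] (0 : ℝ), 0 < Real.sin θ := by
    filter_upwards [Ioo_mem_nhdsGT Real.pi_pos] with θ hθ
    exact Real.sin_pos_of_pos_of_lt_pi hθ.1 hθ.2
  obtain ⟨θ, h1, h2, h3⟩ := ((e1.filter_mono nhdsWithin_le_nhds).and
    ((e2.filter_mono nhdsWithin_le_nhds).and e3)).exists
  refine ⟨rot i j h θ, rot_FU hij hf (hS i hi j hj) θ, h1, ?_⟩
  rw [Finset.ssubset_iff_of_subset]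
  · refine ⟨(i, k), ?_, ?_⟩
    · have hik : rot i j h θ i ⬝ᵥ rot i j h θ k = Real.sin θ * (h j ⬝ᵥ h k) := by
        have a1 : rot i j h θ i = Real.cos θ • h i + Real.sin θ • h j := by simp [rot]
        have a2 : rot i j h θ k = h k := by simp [rot, hki, hkj]
        rw [a1, a2, add_dotProduct, smul_dotProduct, smul_dotProduct, hS i hi k hkS]
        simp
      simp only [prs, Finset.mem_filter, Finset.mem_univ, true_and]
      rw [hik]
      exact mul_ne_zero h3.ne' hk
    · simp only [prs, Finset.mem_filter, Finset.mem_univ, true_and, not_not]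
      exact hS i hi k hkS
  · intro x hx
    simp only [prs, Finset.mem_filter, Finset.mem_univ, true_and] at hx ⊢
    exact h2 x hx

lemma exists_conn {N d : ℕ} (hd : 0 < d) (hN : d < N) (p : MvPolynomial (Fin d × Fin N) ℝ)
    {h : Fin N → Fin d → ℝ} (hf : FU h) (hp : MvPolynomial.eval (fun v => h v.2 v.1) p ≠ 0) :
    ∃ h' : Fin N → Fin d → ℝ, FU h' ∧ MvPolynomial.eval (fun v => h' v.2 v.1) p ≠ 0 ∧ Conn h' := by
  induction hm : N * N - (prs h).card using Nat.strong_induction_on generalizing h with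
  | _ m ih =>
    by_cases hc : Conn h
    · exact ⟨h, hf, hp, hc⟩
    · obtain ⟨h', h1, h2, h3⟩ := improve hd hN p hf hp hc
      have h4 := Finset.card_lt_card h3
      have h5 := Finset.card_le_univ (prs h')
      rw [Fintype.card_prod, Fintype.card_fin] at h5
      exact ih (N * N - (prs h').card) (by omega) h1 h2 rfl

lemma near_ne {N d : ℕ} (i0 : Fin N) (hd : 0 < d) (p : MvPolynomial (Fin d × Fin N) ℝ)
    {h : Fin N → Fin d → ℝ} (hf : FU h) (hp : MvPolynomial.eval (fun v => h v.2 v.1) p ≠ 0)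
    (hc : Conn h) : ∃ ε > 0, ∀ x : Fin N → Fin d → ℝ, (∀ n, dist (x n) (h n) < ε) →
      x ∈ UU N d ∧ MvPolynomial.eval (fun v => Phi x v.2 v.1) p ≠ 0 := by
  have hU : h ∈ UU N d := ⟨_, FU_sol hf hc⟩
  have e1 : ∀ᶠ x in 𝓝 h, x ∈ UU N d := (UU_open i0 hd).mem_nhds hU
  have e2 : ∀ᶠ x in 𝓝 h, MvPolynomial.eval (fun v => Phi x v.2 v.1) p ≠ 0 := by
    refine (eval_analyticAt i0 hd p hU).continuousAt.eventually_ne ?_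
    rw [FU_Phi i0 hd hf hc]
    exact hp
  obtain ⟨ε, hε, hb⟩ := Metric.eventually_nhds_iff.1 (e1.and e2)
  exact ⟨ε, hε, fun x hx => hb ((dist_pi_lt_iff hε).2 hx)⟩

lemma main_aux {N d : ℕ} (hd : 3 ≤ d) (hN : d + 2 ≤ N) (p q : MvPolynomial (Fin d × Fin N) ℝ)
    (h : ∀ F : Fin N → Fin d → ℝ, FU F → MvPolynomial.eval (fun v => F v.2 v.1) p = 0 ∨
      MvPolynomial.eval (fun v => F v.2 v.1) q = 0)
    {F H : Fin N → Fin d → ℝ} (hF : FU F) (hH : FU H)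
    (hpF : MvPolynomial.eval (fun v => F v.2 v.1) p ≠ 0)
    (hqH : MvPolynomial.eval (fun v => H v.2 v.1) q ≠ 0) : False := by
  have i0 : Fin N := ⟨0, by omega⟩
  have hd0 : 0 < d := by omega
  obtain ⟨F, hF, hpF, hcF⟩ := exists_conn hd0 (by omega) p hF hpF
  obtain ⟨H, hH, hqH, hcH⟩ := exists_conn hd0 (by omega) q hH hqH
  obtain ⟨ε₁, he₁, h₁⟩ := near_ne i0 hd0 p hF hpF hcF
  obtain ⟨ε₂, he₂, h₂⟩ := near_ne i0 hd0 q hH hqH hcH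
  obtain ⟨c, hc, hgen⟩ := exists_gen (Sum.elim F H) (lt_min he₁ he₂)
  have hF' := h₁ (fun n => c (Sum.inl n)) fun n =>
    lt_of_lt_of_le (by simpa using hc (Sum.inl n)) (min_le_left _ _)
  have hH' := h₂ (fun n => c (Sum.inr n)) fun n =>
    lt_of_lt_of_le (by simpa using hc (Sum.inr n)) (min_le_right _ _)
  have hstart : ∀ᶠ x in 𝓝 (fun n => c (Sum.inl n)),
      MvPolynomial.eval (fun v => Phi x v.2 v.1) q = 0 := by
    have e1 : ∀ᶠ x in 𝓝 (fun n => c (Sum.inl n)), x ∈ UU N d :=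
      (UU_open i0 hd0).mem_nhds hF'.1
    have e2 : ∀ᶠ x in 𝓝 (fun n => c (Sum.inl n)),
        MvPolynomial.eval (fun v => Phi x v.2 v.1) p ≠ 0 :=
      (eval_analyticAt i0 hd0 p hF'.1).continuousAt.eventually_ne hF'.2
    filter_upwards [e1, e2] with x hx1 hx2
    exact (h _ (Phi_FU hx1)).resolve_left hx2
  have := chain hd hN (fun f => f ∈ UU N d ∧ ∀ᶠ x in 𝓝 f,
    MvPolynomial.eval (fun v => Phi x v.2 v.1) q = 0)
    (fun f f' hs hf => segment_step i0 hd0 q hs hf) c hgen ⟨hF'.1, hstart⟩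
  exact hH'.2 this.2.self_of_nhds

end FuntfAux

/-- `𝓕_{N,d}^ℝ` is an irreducible real algebraic variety for `N ≥ d + 2 > 4`: if every FUNTF
is a zero of `p` or a zero of `q`, then every FUNTF is a zero of `p`, or every FUNTF is a
zero of `q`. -/
theorem funtf_real_irreducible (N d : ℕ) (hd : 3 ≤ d) (hN : d + 2 ≤ N)
    (p q : MvPolynomial (Fin d × Fin N) ℝ)
    (h : ∀ F ∈ FUNTF ℝ N d, evalEntries p F = 0 ∨ evalEntries q F = 0) :
    (∀ F ∈ FUNTF ℝ N d, evalEntries p F = 0) ∨ (∀ F ∈ FUNTF ℝ N d, evalEntries q F = 0) := by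
  by_contra hcon
  push Not at hcon
  obtain ⟨⟨F, hF, hpF⟩, ⟨H, hH, hqH⟩⟩ := hcon
  have conv : ∀ F : Matrix (Fin d) (Fin N) ℝ, F ∈ FUNTF ℝ N d ↔
      FuntfAux.FU (fun n a => F a n) := by
    intro F
    have e : F * F.conjTranspose = ∑ n, Matrix.vecMulVec (fun a => F a n) (fun a => F a n) := by
      ext a b
      simp [Matrix.mul_apply, Matrix.sum_apply, Matrix.vecMulVec_apply]
    have e2 : ∀ n, (F.conjTranspose * F) n n = (fun a => F a n) ⬝ᵥ (fun a => F a n) := by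
      intro n
      simp [Matrix.mul_apply, dotProduct]
    simp only [FUNTF, FuntfAux.FU, Set.mem_ofPred_eq, e, e2]
  refine FuntfAux.main_aux hd hN p q ?_ ((conv F).1 hF) ((conv H).1 hH) hpF hqH
  intro G hG
  exact h (Matrix.of fun a n => G n a) ((conv _).2 hG)
end
end

section
/- For every d ≥ 1 and every N ≥ d, the set of full spark frames in 𝓕_{N,d}^ℝ is generic in 𝓕_{N,d}^ℝ: it contains a subset that is both open and dense in 𝓕_{N,d}^ℝ with the subspace topology induced from the space of d×N real matrices. -/
noncomputable section

/-- A `d × N` matrix is full spark if every `d` of its columns are linearly independent. -/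
def FullSpark {𝕜 : Type*} [RCLike 𝕜] {m n : ℕ} (F : Matrix (Fin m) (Fin n) 𝕜) : Prop :=
  ∀ s : Finset (Fin n), s.card = m →
    LinearIndependent 𝕜 (fun j : s => (fun i => F i (j : Fin n)))

namespace FSG

open Filter Topology

/-- Entrywise version of the tight frame condition. -/
theorem mem_iff {N d : ℕ} (F : Matrix (Fin d) (Fin N) ℝ) :
    F ∈ FUNTF ℝ N d ↔
      (∀ a b, ∑ n, F a n * F b n = if a = b then (N : ℝ) / d else 0) ∧
      ∀ n, ∑ a, F a n * F a n = 1 := by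
  unfold FUNTF
  simp only [Set.mem_ofPred_eq, ← Matrix.ext_iff, Matrix.mul_apply, Matrix.conjTranspose_apply,
    star_trivial, Matrix.smul_apply, Matrix.one_apply, smul_eq_mul, mul_ite, mul_one, mul_zero]

/-- Inner product of columns. -/
def Q {N d : ℕ} (i j : Fin N) (F : Matrix (Fin d) (Fin N) ℝ) : ℝ := ∑ a, F a i * F a j

/-- Minor along `σ`. -/
def D {N d : ℕ} (σ : Fin d → Fin N) (F : Matrix (Fin d) (Fin N) ℝ) : ℝ :=
  (F.submatrix id σ).det

theorem continuous_Q {N d : ℕ} (i j : Fin N) : Continuous (Q (d := d) i j) := by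
  unfold Q
  fun_prop

theorem continuous_D {N d : ℕ} (σ : Fin d → Fin N) : Continuous (D (d := d) σ) := by
  unfold D
  fun_prop

/-- Points with locally stable zero pattern are dense. -/
theorem dense_stable {X ι : Type*} [TopologicalSpace X] [Finite ι] (g : ι → X → ℝ)
    (hg : ∀ i, Continuous (g i)) :
    Dense {x | ∀ i, g i x = 0 → ∀ᶠ y in 𝓝 x, g i y = 0} := by
  have key : Dense (⋂₀ (Set.range fun i => {x | g i x ≠ 0} ∪ interior {x | g i x = 0})) := by
    apply Set.Finite.dense_sInter (Set.finite_range _)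
    · rintro _ ⟨i, rfl⟩
      exact (isOpen_ne_fun (hg i) continuous_const).union isOpen_interior
    · rintro _ ⟨i, rfl⟩
      rw [dense_iff_inter_open]
      intro U hU ⟨x, hx⟩
      by_cases h : ∃ y ∈ U, g i y ≠ 0
      · obtain ⟨y, hy, hy'⟩ := h
        exact ⟨y, hy, Or.inl hy'⟩
      · push Not at h
        exact ⟨x, hx, Or.inr (mem_interior.2 ⟨U, h, hU, hx⟩)⟩
  refine key.mono ?_
  intro x hx i hi
  have := hx _ ⟨i, rfl⟩
  rcases this with h | h
  · exact absurd hi h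
  · exact mem_interior_iff_mem_nhds.1 h

/-- Rotate two columns. -/
def rot {N d : ℕ} (i j : Fin N) (F : Matrix (Fin d) (Fin N) ℝ) (t : ℝ) :
    Matrix (Fin d) (Fin N) ℝ := fun a n =>
  if n = i then Real.cos t * F a i + Real.sin t * F a j
  else if n = j then - Real.sin t * F a i + Real.cos t * F a j else F a n

theorem rot_mem {N d : ℕ} {i j : Fin N} (hij : i ≠ j) {F : Matrix (Fin d) (Fin N) ℝ}
    (hF : F ∈ FUNTF ℝ N d) (h0 : Q i j F = 0) (t : ℝ) : rot i j F t ∈ FUNTF ℝ N d := by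
  rw [mem_iff] at hF ⊢
  obtain ⟨h1, h2⟩ := hF
  have hcs := Real.sin_sq_add_cos_sq t
  constructor
  · intro a b
    rw [← h1 a b, ← Finset.add_sum_erase _ _ (Finset.mem_univ i),
      ← Finset.add_sum_erase _ _ (Finset.mem_univ i),
      ← Finset.add_sum_erase _ _ (Finset.mem_erase.2 ⟨hij.symm, Finset.mem_univ j⟩),
      ← Finset.add_sum_erase _ _ (Finset.mem_erase.2 ⟨hij.symm, Finset.mem_univ j⟩),
      ← add_assoc, ← add_assoc]
    congr 1
    · simp only [rot, if_true, if_neg hij.symm]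
      linear_combination (F a i * F b i + F a j * F b j) * hcs
    · apply Finset.sum_congr rfl
      intro n hn
      simp only [Finset.mem_erase] at hn
      simp [rot, hn.1, hn.2.1]
  · intro n
    have hi := h2 i
    have hj := h2 j
    unfold Q at h0
    by_cases hni : n = i
    · subst hni
      have : ∀ a, rot n j F t a n * rot n j F t a n = Real.cos t ^ 2 * (F a n * F a n) +
          Real.sin t ^ 2 * (F a j * F a j) + 2 * Real.cos t * Real.sin t * (F a n * F a j) := by
        intro a
        simp only [rot, if_true]
        ring
      simp only [this, Finset.sum_add_distrib, ← Finset.mul_sum, hi, hj, h0]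
      linarith
    · by_cases hnj : n = j
      · subst hnj
        have : ∀ a, rot i n F t a n * rot i n F t a n = Real.sin t ^ 2 * (F a i * F a i) +
            Real.cos t ^ 2 * (F a n * F a n) - 2 * Real.cos t * Real.sin t * (F a i * F a n) := by
          intro a
          simp only [rot, if_true, if_neg hni]
          ring
        simp only [this, Finset.sum_add_distrib, Finset.sum_sub_distrib, ← Finset.mul_sum,
          hi, hj, h0]
        linarith
      · simpa [rot, hni, hnj] using h2 n

theorem rot_zero {N d : ℕ} (i j : Fin N) (F : Matrix (Fin d) (Fin N) ℝ) : rot i j F 0 = F := by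
  ext a n
  unfold rot
  split_ifs with h1 h2
  · simp [h1]
  · simp [h2]
  · rfl

theorem continuous_rot {N d : ℕ} (i j : Fin N) (F : Matrix (Fin d) (Fin N) ℝ) :
    Continuous (rot i j F) := by
  refine continuous_matrix fun a n => ?_
  unfold rot
  split_ifs <;> fun_prop

theorem Q_comm {N d : ℕ} (i j : Fin N) (F : Matrix (Fin d) (Fin N) ℝ) : Q i j F = Q j i F := by
  unfold Q
  simp only [mul_comm]

theorem orth_step {N d : ℕ} {F : Matrix (Fin d) (Fin N) ℝ} (hF : F ∈ FUNTF ℝ N d)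
    (hQ : ∀ i j, Q i j F = 0 → ∀ᶠ H in 𝓝[FUNTF ℝ N d] F, Q i j H = 0)
    {i j k : Fin N} (hij : i ≠ j) (hki : k ≠ i) (hkj : k ≠ j) (h0 : Q i j F = 0)
    (hik : Q i k F = 0) : Q j k F = 0 := by
  have ht : Tendsto (rot i j F) (𝓝[≠] 0) (𝓝[FUNTF ℝ N d] F) := by
    refine tendsto_nhdsWithin_iff.2 ⟨?_, Eventually.of_forall (rot_mem hij hF h0)⟩
    have := (continuous_rot i j F).tendsto 0
    rw [rot_zero] at this
    exact this.mono_left nhdsWithin_le_nhds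
  have h1 := ht.eventually (hQ i k hik)
  have h2 : ∀ᶠ t : ℝ in 𝓝[≠] 0, t ∈ Set.Ioo (-1 : ℝ) 1 :=
    nhdsWithin_le_nhds (Ioo_mem_nhds (by norm_num) (by norm_num))
  have h3 : ∀ᶠ t : ℝ in 𝓝[≠] 0, t ≠ 0 := eventually_mem_nhdsWithin
  obtain ⟨t, h1, h2, h3⟩ := (h1.and (h2.and h3)).exists
  have hs : Real.sin t ≠ 0 := by
    intro h
    have := Real.pi_gt_three
    rw [Real.sin_eq_zero_iff_of_lt_of_lt (by linarith [h2.1]) (by linarith [h2.2])] at h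
    exact h3 h
  have : Q i k (rot i j F t) = Real.cos t * Q i k F + Real.sin t * Q j k F := by
    unfold Q
    rw [Finset.mul_sum, Finset.mul_sum, ← Finset.sum_add_distrib]
    apply Finset.sum_congr rfl
    intro a _
    simp only [rot, if_true, if_neg hki, if_neg hkj]
    ring
  rw [this, hik, mul_zero, zero_add] at h1
  exact (mul_eq_zero.1 h1).resolve_left hs

/-- `F Fᵀ` acts as the scalar `N / d`. -/
theorem frame_apply {N d : ℕ} {F : Matrix (Fin d) (Fin N) ℝ} (hF : F ∈ FUNTF ℝ N d)
    (h : Fin d → ℝ) (a : Fin d) :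
    ∑ n, (∑ b, h b * F b n) * F a n = (N : ℝ) / d * h a := by
  have h1 := ((mem_iff F).1 hF).1
  simp only [Finset.sum_mul]
  rw [Finset.sum_comm]
  have : ∀ b, ∑ n, h b * F b n * F a n = h b * if b = a then (N : ℝ) / d else 0 := by
    intro b
    rw [← h1 b a, Finset.mul_sum]
    exact Finset.sum_congr rfl fun n _ => by ring
  simp only [this]
  simp [mul_comm]

theorem conn {N d : ℕ} (hd : 1 ≤ d) (hN : d < N) {F : Matrix (Fin d) (Fin N) ℝ}
    (hF : F ∈ FUNTF ℝ N d)
    (hQ : ∀ i j, Q i j F = 0 → ∀ᶠ H in 𝓝[FUNTF ℝ N d] F, Q i j H = 0)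
    (p : Fin N → ℝ) (hp : ∀ i j, Q i j F ≠ 0 → p i = p j) (i j : Fin N) : p i = p j := by
  by_contra hne
  have hij : i ≠ j := fun h => hne (by rw [h])
  have h0 : Q i j F = 0 := by
    by_contra h
    exact hne (hp _ _ h)
  have hall : ∀ k, k ≠ i → Q i k F = 0 := by
    intro k hki
    by_cases hkj : k = j
    · rw [hkj]; exact h0
    · by_contra h
      have hjk : Q j k F = 0 := by
        by_contra h'
        exact hne ((hp _ _ h).trans (hp _ _ h').symm)
      exact h (orth_step hF hQ hij.symm hkj hki (by rw [Q_comm]; exact h0) hjk)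
  have h2 : Q i i F = 1 := ((mem_iff F).1 hF).2 i
  have e : ∀ a, F a i = (N : ℝ) / d * F a i := by
    intro a
    rw [← frame_apply hF (fun b => F b i) a, Finset.sum_eq_single i]
    · have : ∑ b, F b i * F b i = 1 := h2
      rw [this, one_mul]
    · intro k _ hk
      have : ∑ b, F b i * F b k = 0 := hall k hk
      rw [this, zero_mul]
    · simp
  have hd' : (0 : ℝ) < d := by exact_mod_cast hd
  have hN' : (d : ℝ) < N := by exact_mod_cast hN
  have hne1 : (N : ℝ) / d ≠ 1 := by
    intro h
    rw [div_eq_one_iff_eq hd'.ne'] at h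
    linarith
  have hz : ∀ a, F a i = 0 := by
    intro a
    have := e a
    have h' : ((N : ℝ) / d - 1) * F a i = 0 := by linarith
    exact (mul_eq_zero.1 h').resolve_left (sub_ne_zero.2 hne1)
  unfold Q at h2
  simp [hz] at h2

/-- Determinants along a rank one perturbation of a singular matrix. -/
theorem det_line {d : ℕ} (A : Matrix (Fin d) (Fin d) ℝ) (u v : Fin d → ℝ) (hv : v ≠ 0)
    (hA : A.mulVec v = 0) (t : ℝ) :
    (A + t • Matrix.vecMulVec u v).det = t * (A + Matrix.vecMulVec u v).det := by
  have hvv : v ⬝ᵥ v ≠ 0 := by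
    rwa [Ne, dotProduct_self_eq_zero]
  have e : A + t • Matrix.vecMulVec u v =
      (A + Matrix.vecMulVec u v) *
        (1 + Matrix.replicateCol Unit (((t - 1) / (v ⬝ᵥ v)) • v) * Matrix.replicateRow Unit v) := by
    rw [← Matrix.vecMulVec_eq, mul_add, mul_one, Matrix.mul_vecMulVec, Matrix.add_mulVec,
      Matrix.mulVec_smul, hA, smul_zero, zero_add]
    ext i j
    simp only [Matrix.add_apply, Matrix.smul_apply, Matrix.vecMulVec_apply, smul_eq_mul,
      Matrix.mulVec_smul, Pi.smul_apply]
    have : (Matrix.vecMulVec u v).mulVec v i = u i * (v ⬝ᵥ v) := by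
      simp [Matrix.mulVec, dotProduct, Matrix.vecMulVec_apply, Finset.mul_sum, mul_assoc]
    rw [this]
    field_simp
    ring
  rw [e, Matrix.det_mul, Matrix.det_one_add_replicateCol_mul_replicateRow, dotProduct_smul,
    smul_eq_mul, div_mul_cancel₀ _ hvv]
  ring

theorem sum_sub_dite {α : Type*} [Fintype α] (P : α → Prop) [DecidablePred P]
    [Fintype {x // P x}] (g : {x // P x} → ℝ) :
    ∑ x, g x = ∑ x, if h : P x then g ⟨x, h⟩ else 0 := by
  have h1 : ∑ x ∈ Finset.univ.filter P, (if h : P x then g ⟨x, h⟩ else 0) =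
      ∑ x : {x // P x}, if h : P x.1 then g ⟨x.1, h⟩ else 0 :=
    Finset.sum_subtype (Finset.univ.filter P) (p := P) (by simp)
      (fun x => if h : P x then g ⟨x, h⟩ else 0)
  rw [Finset.sum_filter_of_ne] at h1
  · rw [h1]
    exact Finset.sum_congr rfl fun x _ => by simp [x.2]
  · intro x _ hx
    by_contra h
    simp [h] at hx

attribute [local instance] Matrix.normedAddCommGroup Matrix.normedSpace

theorem lagrange {N d : ℕ} (hd : 1 ≤ d) (hN : d < N) {F : Matrix (Fin d) (Fin N) ℝ}
    (hF : F ∈ FUNTF ℝ N d)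
    (hQ : ∀ i j, Q i j F = 0 → ∀ᶠ H in 𝓝[FUNTF ℝ N d] F, Q i j H = 0)
    (φ : Matrix (Fin d) (Fin N) ℝ → ℝ) (φ' : Matrix (Fin d) (Fin N) ℝ →L[ℝ] ℝ)
    (hφ' : HasStrictFDerivAt φ φ' F) (hφ : ∀ᶠ H in 𝓝[FUNTF ℝ N d] F, φ H = φ F)
    (X : Matrix (Fin d) (Fin N) ℝ)
    (hX1 : ∀ a b, ∑ n, (F a n * X b n + F b n * X a n) = 0)
    (hX2 : ∀ n, ∑ a, F a n * X a n = 0) : φ' X = 0 := by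
  classical
  let n0 : Fin N := ⟨0, by omega⟩
  let e : Fin d → Fin N → (Matrix (Fin d) (Fin N) ℝ →L[ℝ] ℝ) := fun a n =>
    (ContinuousLinearMap.proj (R := ℝ) (φ := fun _ : Fin N => ℝ) n).comp
      (ContinuousLinearMap.proj (R := ℝ) (φ := fun _ : Fin d => Fin N → ℝ) a)
  have he : ∀ a n (M : Matrix (Fin d) (Fin N) ℝ), e a n M = M a n := fun _ _ _ => rfl
  let I := {ab : Fin d × Fin d // ab.1 ≤ ab.2} ⊕ {n : Fin N // n ≠ n0}
  let f : I → Matrix (Fin d) (Fin N) ℝ → ℝ := Sum.elim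
    (fun ab M => ∑ n, M ab.1.1 n * M ab.1.2 n) (fun n M => ∑ a, M a n.1 * M a n.1)
  let f' : I → (Matrix (Fin d) (Fin N) ℝ →L[ℝ] ℝ) := Sum.elim
    (fun ab => ∑ n, (F ab.1.1 n • e ab.1.2 n + F ab.1.2 n • e ab.1.1 n))
    (fun n => ∑ a, (F a n.1 • e a n.1 + F a n.1 • e a n.1))
  have hf' : ∀ i, HasStrictFDerivAt (f i) (f' i) F := by
    rintro (ab | n)
    · exact HasStrictFDerivAt.fun_sum fun n _ =>
        ((e ab.1.1 n).hasStrictFDerivAt).mul ((e ab.1.2 n).hasStrictFDerivAt)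
    · exact HasStrictFDerivAt.fun_sum fun a _ =>
        ((e a n.1).hasStrictFDerivAt).mul ((e a n.1).hasStrictFDerivAt)
  have hFm := (mem_iff F).1 hF
  have hsub : {M | ∀ i, f i M = f i F} ⊆ FUNTF ℝ N d := by
    intro M hM
    have h1 : ∀ a b, a ≤ b → ∑ n, M a n * M b n = if a = b then (N : ℝ) / d else 0 := by
      intro a b hab
      rw [← hFm.1 a b]
      exact hM (Sum.inl ⟨(a, b), hab⟩)
    have h1' : ∀ a b, ∑ n, M a n * M b n = if a = b then (N : ℝ) / d else 0 := by
      intro a b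
      rcases le_total a b with h | h
      · exact h1 a b h
      · have := h1 b a h
        simp only [mul_comm, eq_comm] at this ⊢
        exact this
    have h2 : ∀ n, n ≠ n0 → ∑ a, M a n * M a n = 1 := by
      intro n hn
      rw [← hFm.2 n]
      exact hM (Sum.inr ⟨n, hn⟩)
    rw [mem_iff]
    refine ⟨h1', fun n => ?_⟩
    by_cases hn : n = n0
    · have t1 : ∑ n, ∑ a, M a n * M a n = ∑ n, ∑ a, F a n * F a n := by
        rw [Finset.sum_comm, Finset.sum_comm (f := fun n a => F a n * F a n)]
        exact Finset.sum_congr rfl fun a _ => by rw [h1', hFm.1]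
      rw [← Finset.add_sum_erase _ _ (Finset.mem_univ n0),
        ← Finset.add_sum_erase (a := n0) _ (fun n => ∑ a, F a n * F a n) (Finset.mem_univ n0)] at t1
      have t2 : ∑ x ∈ Finset.univ.erase n0, ∑ a, M a x * M a x =
          ∑ x ∈ Finset.univ.erase n0, ∑ a, F a x * F a x :=
        Finset.sum_congr rfl fun x hx => by rw [h2 x (Finset.ne_of_mem_erase hx), hFm.2]
      rw [t2] at t1
      rw [hn, ← hFm.2 n0]
      exact add_right_cancel t1
    · exact h2 n hn
  have hext : IsLocalExtrOn φ {M | ∀ i, f i M = f i F} F := by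
    left
    have := nhdsWithin_mono F hsub hφ
    filter_upwards [this] with M hM
    exact hM.ge
  obtain ⟨Λ, Λ₀, hne, hsum⟩ := hext.exists_multipliers_of_hasStrictFDerivAt hf' hφ'
  have hs : ∀ Y : Matrix (Fin d) (Fin N) ℝ, ∑ i, Λ i * f' i Y + Λ₀ * φ' Y = 0 := by
    intro Y
    have : ((∑ i, Λ i • f' i) + Λ₀ • φ') Y = 0 :=
      congrArg (fun L : Matrix (Fin d) (Fin N) ℝ →L[ℝ] ℝ => L Y) hsum
    rw [add_apply, sum_apply] at this
    exact this
  have hfX : ∀ i, f' i X = 0 := by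
    rintro (ab | n)
    · simpa [f', he] using hX1 ab.1.1 ab.1.2
    · have := hX2 n.1
      simp [f', he, Finset.sum_add_distrib, this]
  have hX := hs X
  simp only [hfX, mul_zero, Finset.sum_const_zero, zero_add] at hX
  refine (mul_eq_zero.1 hX).resolve_left ?_
  intro hΛ₀
  apply hne
  -- now show that all multipliers vanish
  let p : Fin N → ℝ := fun n => if h : n ≠ n0 then Λ (Sum.inr ⟨n, h⟩) else 0
  let B : Fin d → Fin d → ℝ := fun a b => if h : a ≤ b then Λ (Sum.inl ⟨(a, b), h⟩) else 0
  have hs2 : ∀ Y : Matrix (Fin d) (Fin N) ℝ,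
      ∑ a, ∑ b, B a b * ∑ n, (F a n * Y b n + F b n * Y a n) +
        ∑ n, p n * ∑ a, (F a n * Y a n + F a n * Y a n) = 0 := by
    intro Y
    have := hs Y
    rw [hΛ₀, zero_mul, add_zero, Fintype.sum_sum_type] at this
    rw [← this]
    congr 1
    · rw [← Fintype.sum_prod_type'
        (f := fun a b => B a b * ∑ n, (F a n * Y b n + F b n * Y a n)), sum_sub_dite]
      refine Finset.sum_congr rfl fun ab _ => ?_
      by_cases h : ab.1 ≤ ab.2
      · simp [B, h, f', he]
      · simp [B, h]
    · rw [sum_sub_dite]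
      refine Finset.sum_congr rfl fun n _ => ?_
      by_cases h : n = n0
      · simp [p, h]
      · simp [p, h, f', he]
  have hW : ∀ a n, ∑ b, (B a b + B b a) * F b n = - 2 * p n * F a n := by
    intro a n
    have := hs2 fun b m => if b = a then (if m = n then 1 else 0) else 0
    simp only [mul_ite, mul_one, mul_zero, Finset.sum_add_distrib, mul_add, Finset.sum_ite_eq',
      Finset.sum_ite_irrel, Finset.sum_const_zero, Finset.mem_univ, if_true] at this
    simp only [add_mul, Finset.sum_add_distrib]
    linarith
  have hp : ∀ i j, Q i j F ≠ 0 → p i = p j := by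
    intro i j hij
    have h1 : ∑ a, F a j * ∑ b, (B a b + B b a) * F b i = - 2 * p i * Q i j F := by
      simp only [hW, Q, Finset.mul_sum]
      exact Finset.sum_congr rfl fun a _ => by ring
    have h2 : ∑ a, F a i * ∑ b, (B a b + B b a) * F b j = - 2 * p j * Q i j F := by
      simp only [hW, Q, Finset.mul_sum]
      exact Finset.sum_congr rfl fun a _ => by ring
    have h3 : ∑ a, F a j * ∑ b, (B a b + B b a) * F b i =
        ∑ a, F a i * ∑ b, (B a b + B b a) * F b j := by
      simp only [Finset.mul_sum]
      rw [Finset.sum_comm]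
      exact Finset.sum_congr rfl fun a _ => Finset.sum_congr rfl fun b _ => by ring
    rw [h1, h2] at h3
    have h4 := mul_right_cancel₀ hij h3
    linarith
  have hp0 : ∀ n, p n = 0 := by
    intro n
    rw [conn hd hN hF hQ p hp n n0]
    simp [p]
  have hc : (N : ℝ) / d ≠ 0 := by
    have hd' : (0 : ℝ) < d := by exact_mod_cast hd
    have hN' : (d : ℝ) < N := by exact_mod_cast hN
    exact (div_pos (hd'.trans hN') hd').ne'
  have hB : ∀ a b, B a b + B b a = 0 := by
    intro a b
    have := frame_apply hF (fun b => B a b + B b a) b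
    simp only [hW, hp0, mul_zero, zero_mul, Finset.sum_const_zero] at this
    exact (mul_eq_zero.1 this.symm).resolve_left hc
  refine Prod.ext (funext ?_) hΛ₀
  rintro (⟨⟨a, b⟩, hab⟩ | ⟨n, hn⟩)
  · have hab' : a ≤ b := hab
    have e1 : B a b = Λ (Sum.inl ⟨(a, b), hab⟩) := by simp [B, hab']
    have h0 := hB a b
    show Λ (Sum.inl ⟨(a, b), hab⟩) = 0
    rw [← e1]
    rcases hab'.eq_or_lt with h | h
    · subst h
      linarith
    · have e2 : B b a = 0 := by simp [B, h]
      linarith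
  · have := hp0 n
    simpa [p, hn] using this

theorem strict_D {N d : ℕ} (σ : Fin d → Fin N) (F : Matrix (Fin d) (Fin N) ℝ) :
    ∃ φ' : Matrix (Fin d) (Fin N) ℝ →L[ℝ] ℝ, HasStrictFDerivAt (D σ) φ' F := by
  have h : ContDiff ℝ 1 (D (d := d) σ) := by
    unfold D
    simp only [Matrix.det_apply]
    refine ContDiff.sum fun τ _ => ContDiff.const_smul _ (contDiff_prod fun i _ => ?_)
    have h2 : ContDiff ℝ 1 (fun M : Fin d → Fin N → ℝ => M (τ i) (σ i)) := by fun_prop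
    exact h2
  exact ⟨_, (h.contDiffAt (x := F)).hasStrictFDerivAt one_ne_zero⟩

/-- The main perturbation step: a corank one minor cannot vanish identically near `F`. -/
theorem corank_one {N d : ℕ} (hd : 1 ≤ d) (hN : d < N) {F : Matrix (Fin d) (Fin N) ℝ}
    (hF : F ∈ FUNTF ℝ N d)
    (hQ : ∀ i j, Q i j F = 0 → ∀ᶠ H in 𝓝[FUNTF ℝ N d] F, Q i j H = 0)
    (σ : Fin d → Fin N) (hσ : Function.Injective σ)
    (hD : ∀ᶠ H in 𝓝[FUNTF ℝ N d] F, D σ H = 0)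
    (l h : Fin d → ℝ) (hl0 : l ≠ 0) (hl : (F.submatrix id σ).mulVec l = 0)
    (hh : Matrix.vecMul h (F.submatrix id σ) = 0) :
    (F.submatrix id σ + Matrix.vecMulVec h l).det = 0 := by
  classical
  have hD0 : D σ F = 0 := hD.self_of_nhdsWithin hF
  obtain ⟨φ', hφ'⟩ := strict_D σ F
  let lam : Fin N → ℝ := fun n => ∑ i, if σ i = n then l i else 0
  have hlam : ∀ i, lam (σ i) = l i := by
    intro i
    simp [lam, hσ.eq_iff]
  have hsuml : ∀ g : Fin N → ℝ, ∑ n, g n * lam n = ∑ i, g (σ i) * l i := by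
    intro g
    simp only [lam, Finset.mul_sum]
    rw [Finset.sum_comm]
    simp
  have hFl : ∀ a, ∑ n, F a n * lam n = 0 := by
    intro a
    rw [hsuml]
    exact congrFun hl a
  let X : Matrix (Fin d) (Fin N) ℝ := fun a n => h a * lam n
  have hX1 : ∀ a b, ∑ n, (F a n * X b n + F b n * X a n) = 0 := by
    intro a b
    have : ∀ n, F a n * X b n + F b n * X a n =
        h b * (F a n * lam n) + h a * (F b n * lam n) := by
      intro n
      simp only [X]
      ring
    simp only [this, Finset.sum_add_distrib, ← Finset.mul_sum, hFl, mul_zero, add_zero]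
  have hX2 : ∀ n, ∑ a, F a n * X a n = 0 := by
    intro n
    have e : ∑ a, F a n * X a n = (∑ a, h a * F a n) * lam n := by
      rw [Finset.sum_mul]
      exact Finset.sum_congr rfl fun a _ => by simp only [X]; ring
    rw [e]
    by_cases hn : ∃ i, σ i = n
    · obtain ⟨i, rfl⟩ := hn
      have : ∑ a, h a * F a (σ i) = 0 := congrFun hh i
      rw [this, zero_mul]
    · push Not at hn
      simp [lam, hn]
  have hz := lagrange hd hN hF hQ (D σ) φ' hφ' (by simpa only [hD0] using hD) X hX1 hX2
  have hline : HasDerivAt (fun t : ℝ => D σ (F + t • X)) (φ' X) 0 := by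
    have h1 : HasDerivAt (fun t : ℝ => F + t • X) X 0 := by
      have h0 := ((hasDerivAt_id (0 : ℝ)).smul_const X).const_add F
      rw [one_smul] at h0
      exact h0
    have h2 : HasFDerivAt (D σ) φ' (F + (0 : ℝ) • X) := by
      simpa using hφ'.hasFDerivAt
    exact h2.comp_hasDerivAt 0 h1
  have heq : ∀ t : ℝ, D σ (F + t • X) =
      t * (F.submatrix id σ + Matrix.vecMulVec h l).det := by
    intro t
    rw [← det_line _ h l hl0 hl]
    unfold D
    congr 1
    ext a i
    show F a (σ i) + t * (h a * lam (σ i)) = F a (σ i) + t * (h a * l i)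
    rw [hlam]
  simp only [heq] at hline
  have h3 := (hasDerivAt_id (0 : ℝ)).mul_const ((F.submatrix id σ + Matrix.vecMulVec h l).det)
  have h4 := h3.unique hline
  rw [hz] at h4
  simpa using h4

/-- The column span along `σ`. -/
def colSpan {N d : ℕ} (F : Matrix (Fin d) (Fin N) ℝ) (σ : Fin d → Fin N) :
    Submodule ℝ (Fin d → ℝ) :=
  Submodule.span ℝ (Set.range fun j => (fun a => F a (σ j)))

/-- If the minor has corank at least two, one column can be exchanged. -/
theorem exchange {N d : ℕ} {F : Matrix (Fin d) (Fin N) ℝ}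
    (hd : 1 ≤ d) (hN : d < N) (hF : F ∈ FUNTF ℝ N d)
    (σ : Fin d → Fin N) (hσ : Function.Injective σ)
    (l h : Fin d → ℝ) (hl0 : l ≠ 0) (hh0 : h ≠ 0) (hl : (F.submatrix id σ).mulVec l = 0)
    (hh : Matrix.vecMul h (F.submatrix id σ) = 0)
    (hdet : (F.submatrix id σ + Matrix.vecMulVec h l).det = 0) :
    ∃ σ' : Fin d → Fin N, Function.Injective σ' ∧ D σ' F = 0 ∧ colSpan F σ < colSpan F σ' := by
  classical
  obtain ⟨x, hx0, hx⟩ := Matrix.exists_mulVec_eq_zero_iff.2 hdet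
  have hvx : (Matrix.vecMulVec h l).mulVec x = (l ⬝ᵥ x) • h := by
    ext a
    simp only [Matrix.mulVec, dotProduct, Matrix.vecMulVec_apply, Pi.smul_apply, smul_eq_mul,
      Finset.sum_mul]
    exact Finset.sum_congr rfl fun i _ => by ring
  rw [Matrix.add_mulVec, hvx] at hx
  have hlx : l ⬝ᵥ x = 0 := by
    have h1 := congrArg (fun v => h ⬝ᵥ v) hx
    simp only [dotProduct_add, Matrix.dotProduct_mulVec, hh, zero_dotProduct, zero_add,
      dotProduct_smul, smul_eq_mul, dotProduct_zero] at h1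
    refine (mul_eq_zero.1 h1).resolve_right ?_
    rwa [dotProduct_self_eq_zero]
  rw [hlx, zero_smul, add_zero] at hx
  obtain ⟨i, hi⟩ : ∃ i, l i ≠ 0 := Function.ne_iff.1 hl0
  have hc : (N : ℝ) / d ≠ 0 := by
    have hd' : (0 : ℝ) < d := by exact_mod_cast hd
    have hN' : (d : ℝ) < N := by exact_mod_cast hN
    exact (div_pos (hd'.trans hN') hd').ne'
  obtain ⟨k, hk⟩ : ∃ k, ∑ a, h a * F a k ≠ 0 := by
    by_contra hcon
    push Not at hcon
    apply hh0
    funext a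
    have := frame_apply hF h a
    simp only [hcon, zero_mul, Finset.sum_const_zero] at this
    exact (mul_eq_zero.1 this.symm).resolve_left hc
  have hhσ : ∀ j, ∑ a, h a * F a (σ j) = 0 := fun j => congrFun hh j
  have hkσ : ∀ j, σ j ≠ k := by
    intro j hj
    exact hk (hj ▸ hhσ j)
  let σ' := Function.update σ i k
  have hσ'i : σ' i = k := Function.update_self ..
  have hσ'j : ∀ j, j ≠ i → σ' j = σ j := fun j hj => Function.update_of_ne hj ..
  refine ⟨σ', ?_, ?_, ?_⟩
  · intro a b hab
    by_cases ha : a = i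
    · by_cases hb : b = i
      · rw [ha, hb]
      · rw [ha, hσ'i, hσ'j b hb] at hab
        exact absurd hab.symm (hkσ b)
    · by_cases hb : b = i
      · rw [hb, hσ'i, hσ'j a ha] at hab
        exact absurd hab (hkσ a)
      · rw [hσ'j a ha, hσ'j b hb] at hab
        exact hσ hab
  · let y : Fin d → ℝ := x - (x i / l i) • l
    have hyi : y i = 0 := by
      simp only [y, Pi.sub_apply, Pi.smul_apply, smul_eq_mul]
      field_simp
      ring
    have hy0 : y ≠ 0 := by
      intro hy
      have hxl : x = (x i / l i) • l := sub_eq_zero.1 hy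
      have h1 : x ⬝ᵥ x = 0 := by
        nth_rewrite 1 [hxl]
        rw [smul_dotProduct, hlx, smul_zero]
      exact hx0 (dotProduct_self_eq_zero.1 h1)
    have hy : (F.submatrix id σ).mulVec y = 0 := by
      simp only [y, Matrix.mulVec_sub, Matrix.mulVec_smul, hx, hl, smul_zero, sub_zero]
    refine Matrix.exists_mulVec_eq_zero_iff.1 ⟨y, hy0, ?_⟩
    rw [← hy]
    ext a
    simp only [Matrix.mulVec, dotProduct, Matrix.submatrix_apply, id]
    refine Finset.sum_congr rfl fun j _ => ?_
    by_cases hj : j = i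
    · rw [hj, hyi, mul_zero, mul_zero]
    · rw [hσ'j j hj]
  · have hmem : ∀ j, j ≠ i → (fun a => F a (σ j)) ∈ colSpan F σ' := by
      intro j hj
      rw [← hσ'j j hj]
      exact Submodule.subset_span ⟨j, rfl⟩
    have hle : colSpan F σ ≤ colSpan F σ' := by
      refine Submodule.span_le.2 ?_
      rintro _ ⟨j, rfl⟩
      by_cases hj : j = i
      · subst hj
        have e : (fun a => F a (σ j)) =
            ∑ m ∈ Finset.univ.erase j, (- (l m / l j)) • (fun a => F a (σ m)) := by
          ext a
          have h1 : ∑ m, F a (σ m) * l m = 0 := congrFun hl a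
          rw [← Finset.add_sum_erase _ _ (Finset.mem_univ j)] at h1
          simp only [Finset.sum_apply, Pi.smul_apply, smul_eq_mul]
          have h2 : ∑ m ∈ Finset.univ.erase j, - (l m / l j) * F a (σ m) =
              - (∑ m ∈ Finset.univ.erase j, F a (σ m) * l m) / l j := by
            rw [← Finset.sum_neg_distrib, Finset.sum_div]
            exact Finset.sum_congr rfl fun m _ => by ring
          rw [h2, eq_div_iff hi]
          linarith
        show (fun a => F a (σ j)) ∈ colSpan F σ'
        rw [e]
        exact Submodule.sum_mem _ fun m hm =>
          Submodule.smul_mem _ _ (hmem m (Finset.ne_of_mem_erase hm))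
      · exact hmem j hj
    refine lt_of_le_of_ne hle ?_
    intro heq
    have hkm : (fun a => F a k) ∈ colSpan F σ := by
      rw [heq, ← hσ'i]
      exact Submodule.subset_span ⟨i, rfl⟩
    have hker : ∀ v ∈ colSpan F σ, h ⬝ᵥ v = 0 := by
      intro v hv
      induction hv using Submodule.span_induction with
      | mem v hv =>
        obtain ⟨j, rfl⟩ := hv
        exact hhσ j
      | zero => exact dotProduct_zero h
      | add v w _ _ hv hw => rw [dotProduct_add, hv, hw, add_zero]
      | smul c v _ hv => rw [dotProduct_smul, hv, smul_zero]
    exact hk (hker _ hkm)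

theorem key {N d : ℕ} (hd : 1 ≤ d) (hN : d < N) {F : Matrix (Fin d) (Fin N) ℝ}
    (hF : F ∈ FUNTF ℝ N d)
    (hQ : ∀ i j, Q i j F = 0 → ∀ᶠ H in 𝓝[FUNTF ℝ N d] F, Q i j H = 0)
    (hD : ∀ σ : Fin d → Fin N, D σ F = 0 → ∀ᶠ H in 𝓝[FUNTF ℝ N d] F, D σ H = 0)
    (σ : Fin d → Fin N) (hσ : Function.Injective σ) : D σ F ≠ 0 := by
  intro h0
  let T := {τ : Fin d → Fin N // Function.Injective τ ∧ D τ F = 0}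
  have : Nonempty T := ⟨⟨σ, hσ, h0⟩⟩
  obtain ⟨⟨τ, hτ, hτ0⟩, hmax⟩ :=
    Finite.exists_max fun τ : T => Module.finrank ℝ (colSpan F τ.1)
  obtain ⟨l, hl0, hl⟩ := Matrix.exists_mulVec_eq_zero_iff.2 hτ0
  obtain ⟨h, hh0, hh⟩ := Matrix.exists_vecMul_eq_zero_iff.2 hτ0
  have hdet := corank_one hd hN hF hQ τ hτ (hD τ hτ0) l h hl0 hl hh
  obtain ⟨τ', h1, h2, h3⟩ := exchange hd hN hF τ hτ l h hl0 hh0 hl hh hdet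
  have h4 := hmax ⟨τ', h1, h2⟩
  have h5 := Submodule.finrank_lt_finrank_of_lt h3
  simp only at h4
  omega

theorem fullSpark_of_D {N d : ℕ} {F : Matrix (Fin d) (Fin N) ℝ}
    (h : ∀ σ : Fin d → Fin N, Function.Injective σ → D σ F ≠ 0) : FullSpark F := by
  intro s hs
  have h1 := Matrix.linearIndependent_cols_of_det_ne_zero
    (h (s.orderEmbOfFin hs) (s.orderEmbOfFin hs).injective)
  rw [← linearIndependent_equiv (s.orderIsoOfFin hs).toEquiv]
  exact h1

theorem D_ne_of_eq {d : ℕ} (hd : 1 ≤ d) {F : Matrix (Fin d) (Fin d) ℝ}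
    (hF : F ∈ FUNTF ℝ d d) (σ : Fin d → Fin d) (hσ : Function.Injective σ) : D σ F ≠ 0 := by
  have h1 := hF.1
  have hd' : (d : ℝ) ≠ 0 := by positivity
  rw [div_self hd', one_smul] at h1
  have h2 : F.det ≠ 0 := by
    intro h
    have := congrArg Matrix.det h1
    rw [Matrix.det_mul, h, zero_mul, Matrix.det_one] at this
    exact zero_ne_one this
  let e := Equiv.ofBijective σ (Finite.injective_iff_bijective.1 hσ)
  have h3 : D σ F = _ := Matrix.det_permute' e F
  rw [h3]
  refine mul_ne_zero ?_ h2
  simp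

theorem main (N d : ℕ) (hd : 1 ≤ d) (hN : d ≤ N) :
    ∃ U : Set (FUNTF ℝ N d), IsOpen U ∧ Dense U ∧
      ∀ F ∈ U, FullSpark (F : Matrix (Fin d) (Fin N) ℝ) := by
  refine ⟨{F | ∀ σ : {σ : Fin d → Fin N // Function.Injective σ}, D σ.1 F.1 ≠ 0}, ?_, ?_, ?_⟩
  · simp only [Set.ofPred_forall]
    exact isOpen_iInter_of_finite fun σ =>
      isOpen_ne_fun ((continuous_D σ.1).comp continuous_subtype_val) continuous_const
  · rcases hN.eq_or_lt with h | h
    · subst h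
      have : {F : FUNTF ℝ d d | ∀ σ : {σ : Fin d → Fin d // Function.Injective σ},
          D σ.1 F.1 ≠ 0} = Set.univ := by
        ext F
        simp only [Set.mem_ofPred_eq, Set.mem_univ, iff_true]
        exact fun σ => D_ne_of_eq hd F.2 σ.1 σ.2
      rw [this]
      exact dense_univ
    · have hst := dense_stable (X := FUNTF ℝ N d) (ι := (Fin N × Fin N) ⊕ (Fin d → Fin N))
        (Sum.elim (fun ij F => Q ij.1 ij.2 F.1) (fun σ F => D σ F.1)) (by
          rintro (ij | σ)
          · exact (continuous_Q _ _).comp continuous_subtype_val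
          · exact (continuous_D _).comp continuous_subtype_val)
      refine hst.mono ?_
      intro F hF σ
      refine key hd h F.2 ?_ ?_ σ.1 σ.2
      · intro i j h0
        have := hF (Sum.inl (i, j)) h0
        rw [nhdsWithin_eq_map_subtype_coe F.2]
        exact this
      · intro τ h0
        have := hF (Sum.inr τ) h0
        rw [nhdsWithin_eq_map_subtype_coe F.2]
        exact this
  · intro F hF
    exact fullSpark_of_D fun σ hσ => hF ⟨σ, hσ⟩

end FSG

/-- For every `d ≥ 1` and `N ≥ d`, the full spark frames are generic in `𝓕_{N,d}^ℝ`: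
they contain a subset that is open and dense in the subspace topology. -/
theorem fullSpark_generic_real (N d : ℕ) (hd : 1 ≤ d) (hN : d ≤ N) :
    ∃ U : Set (FUNTF ℝ N d), IsOpen U ∧ Dense U ∧ ∀ F ∈ U, FullSpark (F : Matrix (Fin d) (Fin N) ℝ) := by
  exact FSG.main N d hd hN
end
end
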